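/- arXiv:2210.10030 — 3 statements merged into one kernel-verified Lean document; each statement's English description precedes it below -/
import Mathlib

section
/- For every ε ∈ (0,1) there exist constants C_ε > 0 and K > 0 such that for every p ∈ (2, 6−ε) and every f ∈ C¹(ℝ³;ℝ) one has sup_{x₀∈ℝ³} ‖r^{−3/p+1/2}·f‖_{L^p(B(x₀,1) ∩ {r ≤ 1})} ≤ C_ε·(p−2)^{−K}·( sup_{x₀∈ℝ³} ‖f‖_{L²(B(x₀,1) ∩ {r ≤ 1})} + sup_{x₀∈ℝ³} ‖∇f‖_{L²(B(x₀,1) ∩ {r ≤ 1})} ), whenever the right-hand side is finite. -/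
noncomputable section
open Real MeasureTheory Filter Metric Set
open scoped ENNReal NNReal Topology FourierTransform

/-- Three-dimensional Euclidean space. -/
abbrev E3 : Type := EuclideanSpace ℝ (Fin 3)

/-- The `i`-th partial derivative of a scalar function on `ℝ³`. -/
def pd (f : E3 → ℝ) (i : Fin 3) (x : E3) : ℝ :=
  fderiv ℝ f x (EuclideanSpace.single i 1)

/-- The Laplacian of a scalar function on `ℝ³`. -/
def lap (f : E3 → ℝ) (x : E3) : ℝ :=
  ∑ i : Fin 3, pd (fun y => pd f i y) i x

/-- `(u, pr)` is a classical solution of the Navier–Stokes equations on the time interval `I`. -/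
def IsNSSol (u : ℝ → E3 → E3) (pr : ℝ → E3 → ℝ) (I : Set ℝ) : Prop :=
  (ContDiff ℝ (⊤:ℕ∞) fun q : ℝ × E3 => u q.1 q.2) ∧
  (ContDiff ℝ (⊤:ℕ∞) fun q : ℝ × E3 => pr q.1 q.2) ∧
  (∀ t ∈ I, ∀ x : E3, ∀ i : Fin 3,
    deriv (fun s => u s x i) t - lap (fun y => u t y i) x
      + (∑ j : Fin 3, u t x j * pd (fun y => u t y i) j x) + pd (pr t) i x = 0) ∧
  (∀ t ∈ I, ∀ x : E3, (∑ i : Fin 3, pd (fun y => u t y i) i x) = 0)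

/-- Rotation by angle `θ` about the `x₃`-axis. -/
def rotZ (θ : ℝ) (x : E3) : E3 :=
  (WithLp.equiv 2 (Fin 3 → ℝ)).symm
    ![x 0 * Real.cos θ - x 1 * Real.sin θ, x 0 * Real.sin θ + x 1 * Real.cos θ, x 2]

/-- A time-dependent vector field is axisymmetric. -/
def AxiSym (u : ℝ → E3 → E3) : Prop := ∀ θ t x, u t (rotZ θ x) = rotZ θ (u t x)

/-- The weak `L^q` (quasi)norm `sup_{λ>0} λ · vol{|f| ≥ λ}^{1/q}`. -/
def wnorm' {F : Type*} [NormedAddCommGroup F] (f : E3 → F) (q : ℝ) : ℝ≥0∞ :=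
  ⨆ (l : ℝ) (_ : 0 < l), ENNReal.ofReal l * (volume {x : E3 | l ≤ ‖f x‖}) ^ (1 / q)

/-- The weak `L^3` norm. -/
def wnorm3 (f : E3 → E3) : ℝ≥0∞ := wnorm' f 3

/-- Distance to the `x₃`-axis. -/
def rr (x : E3) : ℝ := Real.sqrt (x 0 ^ 2 + x 1 ^ 2)

theorem pow_four_le_intervalIntegral {h h' g : ℝ → ℝ} {a b x : ℝ} (hab : 1 / 2 ≤ b - a)
    (hx : x ∈ Icc a b) (hd : ∀ t, HasDerivAt h (h' t) t) (hh' : Continuous h')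
    (hg : Continuous g) (hle : ∀ t ∈ Icc a b, |h' t| ≤ g t) :
    h x ^ 4 ≤ ∫ t in a..b, 8 * |h t| ^ 3 * (|h t| + g t) := by
  have hh : Continuous h := continuous_iff_continuousAt.2 fun t => (hd t).continuousAt
  have hab' : a ≤ b := by linarith
  obtain ⟨y, hy, hmin⟩ := isCompact_Icc.exists_isMinOn (nonempty_Icc.2 hab')
    (hh.pow 4).continuousOn
  have h1 : h y ^ 4 ≤ 2 * ∫ t in a..b, h t ^ 4 := by
    have : ∫ _ in a..b, h y ^ 4 ≤ ∫ t in a..b, h t ^ 4 :=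
      intervalIntegral.integral_mono_on hab' (by simp) ((hh.pow 4).intervalIntegrable _ _)
        fun t ht => hmin ht
    rw [intervalIntegral.integral_const, smul_eq_mul] at this
    have h4 : 0 ≤ h y ^ 4 := by positivity
    nlinarith
  have h2 : h x ^ 4 - h y ^ 4 ≤ ∫ t in a..b, 4 * |h t| ^ 3 * g t := by
    have hc : Continuous fun t => 4 * h t ^ 3 * h' t := by fun_prop
    have e : ∫ t in y..x, 4 * h t ^ 3 * h' t = h x ^ 4 - h y ^ 4 := by
      refine intervalIntegral.integral_eq_sub_of_hasDerivAt (f := fun t => h t ^ 4)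
        (fun t _ => ?_) (hc.intervalIntegrable _ _)
      simpa [Pi.pow_def] using (hd t).pow 4
    rw [← e]
    have hsub : uIoc y x ⊆ Ioc a b := by
      rw [uIoc]
      exact Ioc_subset_Ioc (le_min hy.1 hx.1) (max_le hy.2 hx.2)
    calc ∫ t in y..x, 4 * h t ^ 3 * h' t
        ≤ ‖∫ t in y..x, 4 * h t ^ 3 * h' t‖ := le_abs_self _
      _ ≤ ∫ t in uIoc y x, ‖4 * h t ^ 3 * h' t‖ :=
          intervalIntegral.norm_integral_le_integral_norm_uIoc
      _ ≤ ∫ t in Ioc a b, ‖4 * h t ^ 3 * h' t‖ :=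
          setIntegral_mono_set
            ((hc.norm.intervalIntegrable a b).1) (ae_of_all _ fun _ => norm_nonneg _)
            hsub.eventuallyLE
      _ = ∫ t in a..b, ‖4 * h t ^ 3 * h' t‖ := (intervalIntegral.integral_of_le hab').symm
      _ ≤ _ := by
          refine intervalIntegral.integral_mono_on hab' (hc.norm.intervalIntegrable _ _)
            (Continuous.intervalIntegrable (by fun_prop) _ _) fun t ht => ?_
          rw [norm_mul, norm_mul, norm_pow, Real.norm_eq_abs, Real.norm_eq_abs, Real.norm_eq_abs,
            abs_of_pos (by norm_num : (0 : ℝ) < 4)]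
          exact mul_le_mul_of_nonneg_left (hle t ht) (by positivity)
  have h3 : (2 * ∫ t in a..b, h t ^ 4) + ∫ t in a..b, 4 * |h t| ^ 3 * g t
      ≤ ∫ t in a..b, 8 * |h t| ^ 3 * (|h t| + g t) := by
    rw [← intervalIntegral.integral_const_mul, ← intervalIntegral.integral_add
      (Continuous.intervalIntegrable (by fun_prop) _ _)
      (Continuous.intervalIntegrable (by fun_prop) _ _)]
    refine intervalIntegral.integral_mono_on hab'
      (Continuous.intervalIntegrable (by fun_prop) _ _)
      (Continuous.intervalIntegrable (by fun_prop) _ _) fun t ht => ?_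
    have e4 : h t ^ 4 = |h t| ^ 3 * |h t| := by
      rw [← pow_succ, Even.pow_abs (by decide)]
    have : 0 ≤ |h t| ^ 3 * |h t| := by positivity
    have : 0 ≤ |h t| ^ 3 * g t :=
      mul_nonneg (by positivity) ((abs_nonneg _).trans (hle t ht))
    rw [e4]
    nlinarith
  linarith

/-- The Sobolev inequality `H¹ ⊆ L⁶` on three-dimensional boxes. -/
theorem lintegral_Icc_enorm_rpow_six_le {F G : (Fin 3 → ℝ) → ℝ} {D : Fin 3 → (Fin 3 → ℝ) → ℝ}
    {a b : Fin 3 → ℝ} (hab : ∀ i, 1 / 2 ≤ b i - a i) (hF : Continuous F) (hG : Continuous G)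
    (hD : ∀ i, Continuous (D i))
    (hd : ∀ i v, HasDerivAt (fun t => F (Function.update v i t)) (D i v) (v i))
    (hle : ∀ i, ∀ v ∈ Icc a b, |D i v| ≤ G v) :
    ∫⁻ v in Icc a b, ‖F v‖ₑ ^ (6 : ℝ) ≤
      8 ^ 6 * (∫⁻ v in Icc a b, (‖F v‖ₑ + ‖G v‖ₑ) ^ (2 : ℝ)) ^ (3 : ℝ) := by
  set H : (Fin 3 → ℝ) → ℝ≥0∞ :=
    (Icc a b).indicator fun v => 8 * ‖F v‖ₑ ^ (3 : ℝ) * (‖F v‖ₑ + ‖G v‖ₑ) with hH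
  have hHm : Measurable H := by
    refine Measurable.indicator ?_ measurableSet_Icc
    fun_prop
  have key : ∀ v ∈ Icc a b, ∀ i, ‖F v‖ₑ ^ (4 : ℝ) ≤ ∫⁻ t, H (Function.update v i t) := by
    intro v hv i
    have hmem : ∀ t ∈ Icc (a i) (b i), Function.update v i t ∈ Icc a b := by
      intro t ht
      rw [← pi_univ_Icc] at hv ⊢
      intro j _
      rcases eq_or_ne j i with rfl | hj
      · simpa using ht
      · simpa [hj] using hv j (mem_univ _)
    have hvi : v i ∈ Icc (a i) (b i) := ⟨hv.1 i, hv.2 i⟩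
    have hab' : a i ≤ b i := hvi.1.trans hvi.2
    have hcu : Continuous fun t => Function.update v i t := continuous_const.update i continuous_id
    have h1 := pow_four_le_intervalIntegral (h := fun t => F (Function.update v i t))
      (h' := fun t => D i (Function.update v i t)) (g := fun t => G (Function.update v i t))
      (hab i) hvi (fun t => by simpa using hd i (Function.update v i t))
      ((hD i).comp hcu) (hG.comp hcu) (fun t ht => hle i _ (hmem t ht))
    simp only [Function.update_eq_self] at h1
    have hFc := hF.comp hcu
    have hGc := hG.comp hcu
    simp only [Function.comp_def] at hFc hGc
    have hG0 : ∀ t ∈ Icc (a i) (b i), 0 ≤ G (Function.update v i t) := fun t ht =>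
      (abs_nonneg _).trans (hle i _ (hmem t ht))
    calc ‖F v‖ₑ ^ (4 : ℝ) = ENNReal.ofReal (F v ^ 4) := by
          rw [← ofReal_norm, Real.norm_eq_abs, ENNReal.ofReal_rpow_of_nonneg (abs_nonneg _)
            (by norm_num)]
          congr 1
          norm_cast
          exact Even.pow_abs (by decide) _
      _ ≤ ENNReal.ofReal (∫ t in Ioc (a i) (b i), _) := by
          rw [← intervalIntegral.integral_of_le hab']
          exact ENNReal.ofReal_le_ofReal h1
      _ = ∫⁻ t in Ioc (a i) (b i), ENNReal.ofReal (8 * |F (Function.update v i t)| ^ 3 *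
            (|F (Function.update v i t)| + G (Function.update v i t))) := by
          refine ofReal_integral_eq_lintegral_ofReal ?_ ?_
          · exact ((by fun_prop : Continuous _).intervalIntegrable (μ := volume) _ _).1
          · refine (ae_restrict_iff' measurableSet_Ioc).2 (ae_of_all _ fun t ht => ?_)
            have := hG0 t (Ioc_subset_Icc_self ht)
            simp only [Pi.zero_apply]
            positivity
      _ = ∫⁻ t in Ioc (a i) (b i), H (Function.update v i t) := by
          refine setLIntegral_congr_fun measurableSet_Ioc fun t ht => ?_
          have ht' := Ioc_subset_Icc_self ht
          have h0 := hG0 t ht'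
          simp only [hH, indicator_of_mem (hmem t ht')]
          rw [ENNReal.ofReal_mul (by positivity), ENNReal.ofReal_mul (by norm_num),
            ENNReal.ofReal_add (abs_nonneg _) h0, ← Real.norm_eq_abs, ofReal_norm,
            ENNReal.ofReal_pow (norm_nonneg _), ofReal_norm, ← enorm_of_nonneg h0]
          norm_num
      _ ≤ ∫⁻ t, H (Function.update v i t) := setLIntegral_le_lintegral _ _
  set X := ∫⁻ v in Icc a b, ‖F v‖ₑ ^ (6 : ℝ) with hX
  set Y := ∫⁻ v in Icc a b, (‖F v‖ₑ + ‖G v‖ₑ) ^ (2 : ℝ) with hY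
  have h1 : X ≤ (∫⁻ v, H v) ^ (3 / 2 : ℝ) := by
    have hp : ((Fintype.card (Fin 3) : ℕ) : ℝ).HolderConjugate (3 / 2 : ℝ) := by
      rw [Real.holderConjugate_iff]; norm_num
    refine le_trans ?_ (lintegral_prod_lintegral_pow_le (fun _ : Fin 3 => volume) hp hHm)
    refine le_trans ?_ (setLIntegral_le_lintegral (Icc a b) _)
    refine setLIntegral_mono' measurableSet_Icc fun v hv => ?_
    rw [Fin.prod_univ_three]
    have e : ‖F v‖ₑ ^ (6 : ℝ) = (‖F v‖ₑ ^ (4 : ℝ)) ^ (1 / 2 : ℝ) * (‖F v‖ₑ ^ (4 : ℝ)) ^ (1 / 2 : ℝ)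
        * (‖F v‖ₑ ^ (4 : ℝ)) ^ (1 / 2 : ℝ) := by
      simp only [← ENNReal.rpow_mul]
      rw [← ENNReal.rpow_add_of_nonneg _ _ (by norm_num) (by norm_num),
        ← ENNReal.rpow_add_of_nonneg _ _ (by norm_num) (by norm_num)]
      norm_num
    rw [e, show 1 / (((Fintype.card (Fin 3) : ℕ) : ℝ) - 1) = 1 / 2 by norm_num]
    gcongr <;> exact key v hv _
  have h2 : ∫⁻ v, H v ≤ 8 * (X ^ (1 / 2 : ℝ) * Y ^ (1 / 2 : ℝ)) := by
    rw [hH, lintegral_indicator measurableSet_Icc]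
    simp only [mul_assoc]
    rw [lintegral_const_mul _ (by fun_prop)]
    gcongr
    have := ENNReal.lintegral_mul_le_Lp_mul_Lq (volume.restrict (Icc a b))
      Real.HolderConjugate.two_two (f := fun v => ‖F v‖ₑ ^ (3 : ℝ))
      (g := fun v => ‖F v‖ₑ + ‖G v‖ₑ) (by fun_prop) (by fun_prop)
    simpa only [Pi.mul_apply, ← ENNReal.rpow_mul, (by norm_num : (3 : ℝ) * 2 = 6)] using this
  have hXfin : X ≠ ⊤ := by
    have hc : ContinuousOn (fun v => |F v| ^ (6 : ℝ)) (Icc a b) :=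
      (Continuous.rpow_const (by fun_prop) fun _ => Or.inr (by norm_num)).continuousOn
    have := (hc.integrableOn_compact isCompact_Icc (μ := volume)).2
    rw [hasFiniteIntegral_iff_enorm] at this
    rw [hX, ← lt_top_iff_ne_top]
    convert this using 3 with v
    rw [← ofReal_norm, Real.norm_eq_abs, ENNReal.ofReal_rpow_of_nonneg (abs_nonneg _)
      (by norm_num), enorm_of_nonneg (by positivity)]
  rcases eq_or_ne X 0 with h0 | h0
  · rw [h0]; exact zero_le
  have h3 : X ≤ 8 ^ (3 / 2 : ℝ) * X ^ (3 / 4 : ℝ) * Y ^ (3 / 4 : ℝ) := by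
    calc X ≤ _ := h1
      _ ≤ (8 * (X ^ (1 / 2 : ℝ) * Y ^ (1 / 2 : ℝ))) ^ (3 / 2 : ℝ) := by gcongr
      _ = _ := by
        rw [ENNReal.mul_rpow_of_nonneg _ _ (by norm_num),
          ENNReal.mul_rpow_of_nonneg _ _ (by norm_num), ← ENNReal.rpow_mul, ← ENNReal.rpow_mul,
          mul_assoc]
        norm_num
  have h4 : X ^ (1 / 4 : ℝ) ≤ 8 ^ (3 / 2 : ℝ) * Y ^ (3 / 4 : ℝ) := by
    have hne : X ^ (3 / 4 : ℝ) ≠ 0 := by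
      simp only [ne_eq, ENNReal.rpow_eq_zero_iff, h0, hXfin]
      norm_num
    have hnt : X ^ (3 / 4 : ℝ) ≠ ⊤ := ENNReal.rpow_ne_top_of_nonneg (by norm_num) hXfin
    refine (ENNReal.mul_le_mul_iff_right hne hnt).1 ?_
    rw [← ENNReal.rpow_add _ _ h0 hXfin]
    norm_num
    rw [← mul_assoc, mul_comm (X ^ (3 / 4 : ℝ))]
    exact h3
  calc X = (X ^ (1 / 4 : ℝ)) ^ (4 : ℝ) := by rw [← ENNReal.rpow_mul]; norm_num
    _ ≤ (8 ^ (3 / 2 : ℝ) * Y ^ (3 / 4 : ℝ)) ^ (4 : ℝ) := by gcongr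
    _ = _ := by
      rw [ENNReal.mul_rpow_of_nonneg _ _ (by norm_num), ← ENNReal.rpow_mul, ← ENNReal.rpow_mul]
      norm_num

/-- A one-dimensional Hardy inequality on `(0, 1]`, without boundary terms. -/
theorem lintegral_rpow_sub_one_mul_enorm_rpow_le {h h' g : ℝ → ℝ} {b p : ℝ} (hb : 0 < b)
    (hp : 2 < p) (hd : ∀ t, HasDerivAt h (h' t) t) (hh' : Continuous h') (hg : Continuous g)
    (hle : ∀ t ∈ Ioc (0 : ℝ) 1, |h' t| ≤ g t) :
    ENNReal.ofReal b * ∫⁻ s in Ioc (0 : ℝ) 1, ENNReal.ofReal s ^ (b - 1) * ‖h s‖ₑ ^ p ≤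
      ∫⁻ s in Ioc (0 : ℝ) 1, ENNReal.ofReal s ^ b * ‖h s‖ₑ ^ (p - 1) *
        (ENNReal.ofReal (b + 1) * ‖h s‖ₑ + ENNReal.ofReal p * ‖g s‖ₑ) := by
  have hh : Continuous h := continuous_iff_continuousAt.2 fun t => (hd t).continuousAt
  have hcp : ∀ q : ℝ, 0 ≤ q → Continuous fun s => |h s| ^ q := fun q hq =>
    hh.abs.rpow_const fun _ => Or.inr hq
  have hcs : ∀ q : ℝ, 0 ≤ q → Continuous fun s : ℝ => s ^ q := fun q hq =>
    continuous_id.rpow_const fun _ => Or.inr hq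
  have h1 := hcp p (by linarith)
  have h2 := hcp (p - 1) (by linarith)
  have h3 := hcp (p - 2) (by linarith)
  have h4 := hcs b hb.le
  have h5 := hcs (b + 1) (by linarith)
  set A : ℝ → ℝ := fun s => b * s ^ (b - 1) * |h s| ^ p with hA
  set B : ℝ → ℝ := fun s => s ^ b * |h s| ^ (p - 1) * ((b + 1) * |h s| + p * g s) with hB
  set R : ℝ → ℝ := fun s => (b + 1) * s ^ b * |h s| ^ p
    - (s ^ b - s ^ (b + 1)) * (p * |h s| ^ (p - 2) * h s * h' s) with hR
  have hAi : IntervalIntegrable A volume 0 1 :=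
    ((intervalIntegral.intervalIntegrable_rpow' (by linarith)).const_mul b).mul_continuousOn
      h1.continuousOn
  have hBc : Continuous B := by fun_prop
  have hRc : Continuous R := by fun_prop
  have hzero : ∫ s in (0 : ℝ)..1, (A s - R s) = 0 := by
    rw [intervalIntegral.integral_eq_sub_of_hasDerivAt_of_le zero_le_one
      (f := fun s => (s ^ b - s ^ (b + 1)) * |h s| ^ p)
      (Continuous.continuousOn (by fun_prop)) (fun s hs => ?_)
      (hAi.sub (hRc.intervalIntegrable _ _))]
    · simp [Real.zero_rpow hb.ne', Real.zero_rpow (by linarith : b + 1 ≠ 0)]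
    · have e1 := (Real.hasDerivAt_rpow_const (x := s) (p := b) (Or.inl hs.1.ne')).sub
        (Real.hasDerivAt_rpow_const (x := s) (p := b + 1) (Or.inl hs.1.ne'))
      have e2 := (hasDerivAt_abs_rpow (h s) (by linarith : 1 < p)).comp s (hd s)
      refine (e1.mul e2).congr_deriv ?_
      simp only [hA, hR, Function.comp, add_sub_cancel_right, Pi.sub_apply]
      ring
  have hRB : ∀ s ∈ Ioc (0 : ℝ) 1, R s ≤ B s := by
    intro s hs
    have ea : |h s| ^ p = |h s| ^ (p - 1) * |h s| := by
      conv_rhs => rw [← Real.rpow_add_one' (abs_nonneg _) (by linarith)]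
      rw [sub_add_cancel]
    have eb : |h s| ^ (p - 1) = |h s| ^ (p - 2) * |h s| := by
      conv_rhs => rw [← Real.rpow_add_one' (abs_nonneg _) (by linarith)]
      ring_nf
    have ec : s ^ (b + 1) ≤ s ^ b := Real.rpow_le_rpow_of_exponent_ge hs.1 hs.2 (by linarith)
    have ed : 0 ≤ s ^ (b + 1) := Real.rpow_nonneg hs.1.le _
    have h0 : 0 ≤ |h s| ^ (p - 2) := Real.rpow_nonneg (abs_nonneg _) _
    have ee : -((s ^ b - s ^ (b + 1)) * (p * |h s| ^ (p - 2) * h s * h' s)) ≤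
        s ^ b * (p * |h s| ^ (p - 2) * |h s| * g s) := by
      calc _ ≤ |(s ^ b - s ^ (b + 1)) * (p * |h s| ^ (p - 2) * h s * h' s)| := neg_le_abs _
        _ = (s ^ b - s ^ (b + 1)) * (p * |h s| ^ (p - 2) * |h s| * |h' s|) := by
          simp only [abs_mul, abs_of_nonneg h0, abs_of_nonneg (sub_nonneg.2 ec),
            abs_of_pos (by linarith : 0 < p)]
        _ ≤ _ := by
          have := hle s hs
          gcongr
          · linarith
          · linarith
    simp only [hR, hB]
    calc _ ≤ (b + 1) * s ^ b * |h s| ^ p + s ^ b * (p * |h s| ^ (p - 2) * |h s| * g s) := by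
          linarith
      _ = _ := by rw [ea, eb]; ring
  have hint : ∫ s in (0 : ℝ)..1, A s ≤ ∫ s in (0 : ℝ)..1, B s := by
    rw [intervalIntegral.integral_sub hAi (hRc.intervalIntegrable _ _)] at hzero
    have : ∫ s in (0 : ℝ)..1, R s ≤ ∫ s in (0 : ℝ)..1, B s :=
      intervalIntegral.integral_mono_on_of_le_Ioo zero_le_one (hRc.intervalIntegrable _ _)
        (hBc.intervalIntegrable _ _) fun s hs => hRB s (Ioo_subset_Ioc_self hs)
    linarith
  rw [intervalIntegral.integral_of_le zero_le_one, intervalIntegral.integral_of_le zero_le_one]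
    at hint
  have hg0 : ∀ s ∈ Ioc (0 : ℝ) 1, 0 ≤ g s := fun s hs => (abs_nonneg _).trans (hle s hs)
  have hpow : ∀ s (q : ℝ), 0 ≤ q → ‖h s‖ₑ ^ q = ENNReal.ofReal (|h s| ^ q) := by
    intro s q hq
    rw [← ofReal_norm, Real.norm_eq_abs, ENNReal.ofReal_rpow_of_nonneg (abs_nonneg _) hq]
  calc _ = ∫⁻ s in Ioc (0 : ℝ) 1, ENNReal.ofReal (A s) := by
        rw [← lintegral_const_mul _ (by fun_prop)]
        refine setLIntegral_congr_fun measurableSet_Ioc fun s hs => ?_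
        have := Real.rpow_nonneg hs.1.le (b - 1)
        simp only [hA]
        rw [ENNReal.ofReal_mul (by positivity), ENNReal.ofReal_mul hb.le,
          ENNReal.ofReal_rpow_of_pos hs.1, hpow s p (by linarith), mul_assoc]
    _ = ENNReal.ofReal (∫ s in Ioc (0 : ℝ) 1, A s) := by
        refine (ofReal_integral_eq_lintegral_ofReal hAi.1 ?_).symm
        refine (ae_restrict_iff' measurableSet_Ioc).2 (ae_of_all _ fun s hs => ?_)
        have := Real.rpow_nonneg hs.1.le (b - 1)
        simp only [hA, Pi.zero_apply]
        positivity
    _ ≤ ENNReal.ofReal (∫ s in Ioc (0 : ℝ) 1, B s) := ENNReal.ofReal_le_ofReal hint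
    _ = ∫⁻ s in Ioc (0 : ℝ) 1, ENNReal.ofReal (B s) := by
        refine ofReal_integral_eq_lintegral_ofReal (hBc.intervalIntegrable _ _).1 ?_
        refine (ae_restrict_iff' measurableSet_Ioc).2 (ae_of_all _ fun s hs => ?_)
        have := Real.rpow_nonneg hs.1.le b
        have := hg0 s hs
        simp only [hB, Pi.zero_apply]
        positivity
    _ = _ := by
        refine setLIntegral_congr_fun measurableSet_Ioc fun s hs => ?_
        have := Real.rpow_nonneg hs.1.le b
        have hgs := hg0 s hs
        simp only [hB]
        rw [ENNReal.ofReal_mul (by positivity), ENNReal.ofReal_mul (by positivity),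
          ENNReal.ofReal_add (by positivity) (by positivity), ENNReal.ofReal_mul (by positivity),
          ENNReal.ofReal_mul (by positivity), ENNReal.ofReal_rpow_of_pos hs.1,
          hpow s (p - 1) (by linarith), ← Real.norm_eq_abs, ofReal_norm, enorm_of_nonneg hgs]

/-- Cylindrical coordinates `(r, θ, x₃)` on `ℝ³`. -/
def cylPolar (v : Fin 3 → ℝ) : E3 :=
  WithLp.toLp 2 ![v 0 * Real.cos (v 1), v 0 * Real.sin (v 1), v 2]

/-- The coordinate vector fields of `cylPolar`. -/
def cylPolarDeriv (i : Fin 3) (v : Fin 3 → ℝ) : E3 :=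
  ![WithLp.toLp 2 ![Real.cos (v 1), Real.sin (v 1), 0],
    WithLp.toLp 2 ![-(v 0 * Real.sin (v 1)), v 0 * Real.cos (v 1), 0],
    WithLp.toLp 2 ![0, 0, 1]] i

/-- The closed cylinder of radius one and height two centred at height `z` on the axis. -/
def cyl (z : ℝ) : Set E3 := {x | rr x ≤ 1 ∧ x 2 ∈ Icc (z - 1) (z + 1)}

/-- The region of cylindrical coordinates describing `cyl z` up to a null set. -/
def cylBox (z : ℝ) : Set (Fin 3 → ℝ) :=
  {v | v 0 ∈ Ioc (0 : ℝ) 1 ∧ v 1 ∈ Ioo (-π) π ∧ v 2 ∈ Icc (z - 1) (z + 1)}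

theorem continuous_rr : Continuous rr := by
  unfold rr; fun_prop

theorem continuous_cylPolar : Continuous cylPolar := by
  unfold cylPolar
  refine (PiLp.continuous_toLp 2 _).comp (continuous_pi fun i => ?_)
  fin_cases i <;> simp <;> fun_prop

theorem continuous_cylPolarDeriv (i : Fin 3) : Continuous (cylPolarDeriv i) := by
  unfold cylPolarDeriv
  fin_cases i <;> simp <;>
    refine (PiLp.continuous_toLp 2 _).comp (continuous_pi fun j => ?_) <;>
    fin_cases j <;> simp <;> fun_prop

theorem rr_cylPolar {v : Fin 3 → ℝ} (hv : 0 ≤ v 0) : rr (cylPolar v) = v 0 := by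
  have : (v 0 * Real.cos (v 1)) ^ 2 + (v 0 * Real.sin (v 1)) ^ 2 = v 0 ^ 2 := by
    nlinarith [Real.sin_sq_add_cos_sq (v 1)]
  simp [rr, cylPolar, this, Real.sqrt_sq hv]

theorem measurableSet_cyl (z : ℝ) : MeasurableSet (cyl z) :=
  (measurableSet_le continuous_rr.measurable measurable_const).inter
    (measurableSet_Icc.preimage (by fun_prop : Continuous fun x : E3 => x 2).measurable)

theorem measurableSet_cylBox (z : ℝ) : MeasurableSet (cylBox z) :=
  (measurableSet_Ioc.preimage (measurable_pi_apply 0)).inter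
    ((measurableSet_Ioo.preimage (measurable_pi_apply 1)).inter
      (measurableSet_Icc.preimage (measurable_pi_apply 2)))

theorem hasDerivAt_cylPolar_update (i : Fin 3) (v : Fin 3 → ℝ) :
    HasDerivAt (fun t => cylPolar (Function.update v i t)) (cylPolarDeriv i v) (v i) := by
  have h : HasDerivAt (fun t : ℝ => ![Function.update v i t 0 * Real.cos (Function.update v i t 1),
      Function.update v i t 0 * Real.sin (Function.update v i t 1), Function.update v i t 2])
      (WithLp.ofLp (cylPolarDeriv i v)) (v i) := by
    rw [hasDerivAt_pi]
    intro j
    fin_cases i <;> fin_cases j <;> simp [cylPolarDeriv, Function.update]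
    · simpa using (hasDerivAt_id (v 0)).mul_const (Real.cos (v 1))
    · simpa using (hasDerivAt_id (v 0)).mul_const (Real.sin (v 1))
    · exact hasDerivAt_const _ _
    · simpa using (Real.hasDerivAt_cos (v 1)).const_mul (v 0)
    · simpa using (Real.hasDerivAt_sin (v 1)).const_mul (v 0)
    · exact hasDerivAt_const _ _
    · exact hasDerivAt_const _ _
    · exact hasDerivAt_const _ _
    · exact hasDerivAt_id _
  exact ((PiLp.continuousLinearEquiv 2 ℝ fun _ : Fin 3 => ℝ).symm.hasFDerivAt).comp_hasDerivAt _ h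

theorem norm_cylPolarDeriv_le (i : Fin 3) {v : Fin 3 → ℝ} (hv : |v 0| ≤ 1) :
    ‖cylPolarDeriv i v‖ ≤ 1 := by
  have h1 : v 0 ^ 2 ≤ 1 := (sq_le_one_iff_abs_le_one _).2 hv
  have h2 := Real.sin_sq_add_cos_sq (v 1)
  rw [EuclideanSpace.norm_eq, Real.sqrt_le_one]
  fin_cases i
  · simp [cylPolarDeriv, Fin.sum_univ_three]
  · simp [cylPolarDeriv, Fin.sum_univ_three]
    nlinarith
  · simp [cylPolarDeriv, Fin.sum_univ_three]

theorem lintegral_fin_three {Φ : (Fin 3 → ℝ) → ℝ≥0∞} (hΦ : Measurable Φ) :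
    ∫⁻ v, Φ v = ∫⁻ z : ℝ, ∫⁻ q : ℝ × ℝ, Φ ![q.1, q.2, z] := by
  have h1 := (volume_preserving_piFinSuccAbove (fun _ : Fin 3 => ℝ) 2).symm
  rw [← h1.lintegral_comp_emb (MeasurableEquiv.measurableEmbedding _)]
  rw [Measure.volume_eq_prod, lintegral_prod (fun a => Φ _)
    (hΦ.comp h1.measurable).aemeasurable]
  refine lintegral_congr fun z => ?_
  have h2 := (volume_preserving_finTwoArrow ℝ).symm
  rw [← h2.lintegral_comp_emb (MeasurableEquiv.measurableEmbedding _)]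
  refine lintegral_congr fun q => ?_
  congr 1
  ext i
  fin_cases i <;> rfl

theorem lintegral_cyl (z : ℝ) {Φ : E3 → ℝ≥0∞} (hΦ : Measurable Φ) :
    ∫⁻ x in cyl z, Φ x = ∫⁻ v in cylBox z, ENNReal.ofReal (v 0) * Φ (cylPolar v) := by
  have hmP := continuous_cylPolar.measurable
  rw [← lintegral_indicator (measurableSet_cyl z), ← lintegral_indicator (measurableSet_cylBox z),
    ← (PiLp.volume_preserving_toLp (Fin 3)).lintegral_comp_emb
      (MeasurableEquiv.toLp 2 (Fin 3 → ℝ)).measurableEmbedding,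
    lintegral_fin_three, lintegral_fin_three]
  · refine lintegral_congr fun t => ?_
    rw [← lintegral_comp_polarCoord_symm,
      ← lintegral_indicator polarCoord.open_target.measurableSet]
    refine lintegral_congr fun q => ?_
    by_cases hq : q ∈ polarCoord.target
    · rw [indicator_of_mem hq]
      rw [polarCoord_target] at hq
      have e : (WithLp.toLp 2 ![(polarCoord.symm q).1, (polarCoord.symm q).2, t] : E3) =
          cylPolar ![q.1, q.2, t] := by
        simp [cylPolar, polarCoord_symm_apply]
      rw [e]
      have h0 : 0 < q.1 := hq.1
      have hr : rr (cylPolar ![q.1, q.2, t]) = q.1 := rr_cylPolar (v := ![q.1, q.2, t]) h0.le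
      have hiff : cylPolar ![q.1, q.2, t] ∈ cyl z ↔ ![q.1, q.2, t] ∈ cylBox z := by
        have h2 : q.2 ∈ Ioo (-π) π := hq.2
        change (rr _ ≤ 1 ∧ _) ↔ _
        rw [hr]
        simp [cylBox, cylPolar, h0, h2.1, h2.2]
      by_cases hm : ![q.1, q.2, t] ∈ cylBox z
      · rw [indicator_of_mem hm, indicator_of_mem (hiff.2 hm)]
        rfl
      · rw [indicator_of_notMem hm, indicator_of_notMem (mt hiff.1 hm)]
        simp
    · rw [indicator_of_notMem hq, indicator_of_notMem]
      contrapose! hq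
      rw [polarCoord_target]
      exact ⟨hq.1.1, hq.2.1⟩
  · refine Measurable.indicator ?_ (measurableSet_cylBox z)
    fun_prop
  · exact (hΦ.indicator (measurableSet_cyl z)).comp (MeasurableEquiv.toLp 2 (Fin 3 → ℝ)).measurable

/-- The scale-invariant weighted energy `∫ r^{q/2-3} |f|^q` over the cylinder `cyl z`. -/
def hardyEnergy (f : E3 → ℝ) (z q : ℝ) : ℝ≥0∞ :=
  ∫⁻ x in cyl z, ENNReal.ofReal (rr x) ^ (q / 2 - 3) * ‖f x‖ₑ ^ q

/-- An `H¹` norm of `f` over the cylinder `cyl z`. -/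
def sobolevNorm (f : E3 → ℝ) (z : ℝ) : ℝ≥0∞ :=
  (∫⁻ x in cyl z, (‖f x‖ₑ + ‖fderiv ℝ f x‖ₑ) ^ (2 : ℝ)) ^ (1 / 2 : ℝ)

theorem lintegral_cylBox_mono_of_forall_update {z : ℝ} {Ψ₁ Ψ₂ : (Fin 3 → ℝ) → ℝ≥0∞}
    (h₁ : Measurable Ψ₁) (h₂ : Measurable Ψ₂)
    (h : ∀ v, ∫⁻ s in Ioc (0 : ℝ) 1, Ψ₁ (Function.update v 0 s) ≤
      ∫⁻ s in Ioc (0 : ℝ) 1, Ψ₂ (Function.update v 0 s)) :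
    ∫⁻ v in cylBox z, Ψ₁ v ≤ ∫⁻ v in cylBox z, Ψ₂ v := by
  have key : ∀ {Ψ : (Fin 3 → ℝ) → ℝ≥0∞}, Measurable Ψ → ∫⁻ v in cylBox z, Ψ v =
      ∫⁻ w : Fin 2 → ℝ, {w : Fin 2 → ℝ | w 0 ∈ Ioo (-π) π ∧ w 1 ∈ Icc (z - 1) (z + 1)}.indicator
        (fun w => ∫⁻ s in Ioc (0 : ℝ) 1,
          Ψ (Function.update (Fin.insertNth (α := fun _ => ℝ) 0 0 w) 0 s)) w := by
    intro Ψ hΨ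
    have hm := hΨ.indicator (measurableSet_cylBox z)
    have hp := (volume_preserving_piFinSuccAbove (fun _ : Fin 3 => ℝ) 0).symm
    rw [← lintegral_indicator (measurableSet_cylBox z),
      ← hp.lintegral_comp_emb (MeasurableEquiv.measurableEmbedding _),
      Measure.volume_eq_prod, lintegral_prod_symm' (fun a => (cylBox z).indicator Ψ _)
        (hm.comp hp.measurable)]
    refine lintegral_congr fun w => ?_
    have hmem : ∀ s : ℝ, (Fin.insertNth (α := fun _ => ℝ) 0 s w : Fin 3 → ℝ) ∈ cylBox z ↔
        s ∈ Ioc (0 : ℝ) 1 ∧ w 0 ∈ Ioo (-π) π ∧ w 1 ∈ Icc (z - 1) (z + 1) := by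
      intro s
      rfl
    by_cases hw : w 0 ∈ Ioo (-π) π ∧ w 1 ∈ Icc (z - 1) (z + 1)
    · rw [indicator_of_mem (by exact hw), ← lintegral_indicator measurableSet_Ioc]
      refine lintegral_congr fun s => ?_
      simp only [Fin.update_insertNth]
      by_cases hs : s ∈ Ioc (0 : ℝ) 1
      · rw [indicator_of_mem hs]
        exact indicator_of_mem ((hmem s).2 ⟨hs, hw⟩) _
      · rw [indicator_of_notMem hs]
        exact indicator_of_notMem (fun h' => hs ((hmem s).1 h').1) _
    · rw [indicator_of_notMem (by exact hw), lintegral_eq_zero_iff' ?_]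
      · exact ae_of_all _ fun s => indicator_of_notMem (fun h' => hw ((hmem s).1 h').2) _
      · exact (hm.comp (hp.measurable.comp measurable_prodMk_right)).aemeasurable
  rw [key h₁, key h₂]
  exact lintegral_mono fun w => indicator_le_indicator (h _)

theorem ofReal_mul_ofReal_rpow {s : ℝ} (hs : 0 < s) (q : ℝ) :
    ENNReal.ofReal s * ENNReal.ofReal s ^ q = ENNReal.ofReal s ^ (q + 1) := by
  rw [add_comm, ENNReal.rpow_add _ _ (by simpa using hs) ENNReal.ofReal_ne_top, ENNReal.rpow_one]

theorem ofReal_mul_hardyEnergy_le_lintegral_cylBox {f : E3 → ℝ} (hf : ContDiff ℝ 1 f) (z : ℝ)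
    {p : ℝ} (hp : 2 < p) :
    ENNReal.ofReal (p / 2 - 1) * hardyEnergy f z p ≤
      ∫⁻ v in cylBox z, ENNReal.ofReal (v 0) ^ (p / 2 - 1) * ‖f (cylPolar v)‖ₑ ^ (p - 1) *
        (ENNReal.ofReal (p / 2) * ‖f (cylPolar v)‖ₑ
          + ENNReal.ofReal p * ‖fderiv ℝ f (cylPolar v)‖ₑ) := by
  have hfc := hf.continuous
  have hf' := hf.continuous_fderiv one_ne_zero
  have hmP := continuous_cylPolar.measurable
  have hmf := hfc.measurable
  have hmf' := hf'.measurable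
  have hmr := continuous_rr.measurable
  have e : hardyEnergy f z p =
      ∫⁻ v in cylBox z, ENNReal.ofReal (v 0) ^ (p / 2 - 1 - 1) * ‖f (cylPolar v)‖ₑ ^ p := by
    rw [hardyEnergy, lintegral_cyl z (by fun_prop)]
    refine setLIntegral_congr_fun (measurableSet_cylBox z) fun v hv => ?_
    rw [rr_cylPolar hv.1.1.le, ← mul_assoc, ofReal_mul_ofReal_rpow hv.1.1]
    ring_nf
  rw [e, ← lintegral_const_mul _ (by fun_prop)]
  refine lintegral_cylBox_mono_of_forall_update (by fun_prop) (by fun_prop) fun v => ?_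
  have hcu : Continuous fun t => Function.update v 0 t := continuous_const.update 0 continuous_id
  have hmu := hcu.measurable
  have h := lintegral_rpow_sub_one_mul_enorm_rpow_le (b := p / 2 - 1)
    (h := fun t => f (cylPolar (Function.update v 0 t)))
    (h' := fun t => fderiv ℝ f (cylPolar (Function.update v 0 t))
      (cylPolarDeriv 0 (Function.update v 0 t)))
    (g := fun t => ‖fderiv ℝ f (cylPolar (Function.update v 0 t))‖) (by linarith) hp
    (fun t => ?_) ?_ ?_ fun t ht => ?_
  · rw [lintegral_const_mul _ (by fun_prop)]
    simpa only [Function.update_self, enorm_norm, sub_add_cancel] using h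
  · refine ((hf.differentiable one_ne_zero _).hasFDerivAt.comp_hasDerivAt_of_eq t ?_ rfl)
    simpa using hasDerivAt_cylPolar_update 0 (Function.update v 0 t)
  · exact (hf'.comp (continuous_cylPolar.comp hcu)).clm_apply
      ((continuous_cylPolarDeriv 0).comp hcu)
  · exact (hf'.comp (continuous_cylPolar.comp hcu)).norm
  · refine ((fderiv ℝ f _).le_opNorm _).trans (mul_le_of_le_one_right (norm_nonneg _) ?_)
    refine norm_cylPolarDeriv_le 0 ?_
    simpa [abs_of_pos ht.1] using ht.2

theorem hardyEnergy_ne_top {f : E3 → ℝ} (hf : ContDiff ℝ 1 f) (z : ℝ)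
    {p : ℝ} (hp : 2 < p) : hardyEnergy f z p ≠ ⊤ := by
  have hfc := hf.continuous.comp continuous_cylPolar
  have hf' := (hf.continuous_fderiv one_ne_zero).comp continuous_cylPolar
  simp only [Function.comp_def] at hfc hf'
  have hn := hfc.nnnorm
  have hn' := hf'.nnnorm
  have h := ofReal_mul_hardyEnergy_le_lintegral_cylBox hf z hp
  refine (ENNReal.lt_top_of_mul_ne_top_right (h.trans_lt ?_).ne 
    (by simpa using by linarith)).ne
  have h1 : Continuous fun v : Fin 3 → ℝ => (v 0).toNNReal ^ (p / 2 - 1) :=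
    (NNReal.continuous_rpow_const (by linarith)).comp (by fun_prop)
  have h2 : Continuous fun v : Fin 3 → ℝ => ‖f (cylPolar v)‖₊ ^ (p - 1) :=
    (NNReal.continuous_rpow_const (by linarith)).comp hn
  have hlt := setLIntegral_lt_top_of_isCompact (μ := volume) (f := fun v : Fin 3 → ℝ =>
    (v 0).toNNReal ^ (p / 2 - 1) * ‖f (cylPolar v)‖₊ ^ (p - 1) *
      ((p / 2).toNNReal * ‖f (cylPolar v)‖₊ + p.toNNReal * ‖fderiv ℝ f (cylPolar v)‖₊))
    (isCompact_Icc (a := ![0, -π, z - 1]) (b := ![1, π, z + 1])).measure_lt_top.ne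
    isCompact_Icc ((h1.mul h2).mul ((continuous_const.mul hn).add (continuous_const.mul hn')))
  refine lt_of_le_of_lt ?_ hlt
  have hsub : cylBox z ⊆ Icc ![0, -π, z - 1] ![1, π, z + 1] := by
    intro v hv
    obtain ⟨h0, h1, h2⟩ := hv
    constructor <;> intro i <;> fin_cases i
    exacts [h0.1.le, h1.1.le, h2.1, h0.2, h1.2.le, h2.2]
  refine (lintegral_mono_set hsub).trans (lintegral_mono fun v => le_of_eq ?_)
  push_cast
  rw [ENNReal.coe_rpow_of_nonneg _ (by linarith), ENNReal.coe_rpow_of_nonneg _ (by linarith)]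
  rfl

theorem ofReal_mul_hardyEnergy_le {f : E3 → ℝ} (hf : ContDiff ℝ 1 f) (z : ℝ)
    {p : ℝ} (hp : 2 < p) (hp4 : p ≤ 4) :
    ENNReal.ofReal (p / 2 - 1) * hardyEnergy f z p ≤
      6 * (sobolevNorm f z * hardyEnergy f z (2 * p - 2) ^ (1 / 2 : ℝ)) := by
  have hfc := hf.continuous
  have hf' := hf.continuous_fderiv one_ne_zero
  have hmP := continuous_cylPolar.measurable
  have hmf := hfc.measurable
  have hmf' := hf'.measurable
  have hmr := continuous_rr.measurable
  calc _ ≤ _ := ofReal_mul_hardyEnergy_le_lintegral_cylBox hf z hp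
    _ = ∫⁻ x in cyl z, ENNReal.ofReal (rr x) ^ (p / 2 - 2) * ‖f x‖ₑ ^ (p - 1) *
        (ENNReal.ofReal (p / 2) * ‖f x‖ₑ + ENNReal.ofReal p * ‖fderiv ℝ f x‖ₑ) := by
        rw [lintegral_cyl z (by fun_prop)]
        refine setLIntegral_congr_fun (measurableSet_cylBox z) fun v hv => ?_
        rw [rr_cylPolar hv.1.1.le, ← mul_assoc, ← mul_assoc, ofReal_mul_ofReal_rpow hv.1.1]
        ring_nf
    _ ≤ ∫⁻ x in cyl z, 6 * ((‖f x‖ₑ + ‖fderiv ℝ f x‖ₑ) *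
          (ENNReal.ofReal (rr x) ^ (p / 2 - 2) * ‖f x‖ₑ ^ (p - 1))) := by
        refine lintegral_mono fun x => ?_
        have h1 : ENNReal.ofReal (p / 2) ≤ 6 := by
          rw [ENNReal.ofReal_le_iff_le_toReal (by simp)]; norm_num; linarith
        have h2 : ENNReal.ofReal p ≤ 6 := by
          rw [ENNReal.ofReal_le_iff_le_toReal (by simp)]; norm_num; linarith
        calc _ ≤ ENNReal.ofReal (rr x) ^ (p / 2 - 2) * ‖f x‖ₑ ^ (p - 1) *
              (6 * ‖f x‖ₑ + 6 * ‖fderiv ℝ f x‖ₑ) := by gcongr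
          _ = _ := by ring
    _ = 6 * ∫⁻ x in cyl z, (‖f x‖ₑ + ‖fderiv ℝ f x‖ₑ) *
          (ENNReal.ofReal (rr x) ^ (p / 2 - 2) * ‖f x‖ₑ ^ (p - 1)) := by
        rw [lintegral_const_mul _ (by fun_prop)]
    _ ≤ _ := by
        gcongr
        have := ENNReal.lintegral_mul_le_Lp_mul_Lq (volume.restrict (cyl z))
          Real.HolderConjugate.two_two (f := fun x => ‖f x‖ₑ + ‖fderiv ℝ f x‖ₑ)
          (g := fun x => ENNReal.ofReal (rr x) ^ (p / 2 - 2) * ‖f x‖ₑ ^ (p - 1))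
          (by fun_prop) (by fun_prop)
        refine this.trans (le_of_eq ?_)
        rw [sobolevNorm, hardyEnergy]
        congr 2
        refine lintegral_congr fun x => ?_
        rw [ENNReal.mul_rpow_of_nonneg _ _ (by norm_num), ← ENNReal.rpow_mul, ← ENNReal.rpow_mul]
        ring_nf

theorem lintegral_Icc_comp_enorm_rpow_six_le {f : E3 → ℝ} (hf : ContDiff ℝ 1 f)
    {P : (Fin 3 → ℝ) → E3}
    {P' : Fin 3 → (Fin 3 → ℝ) → E3} {a b : Fin 3 → ℝ} (hab : ∀ i, 1 / 2 ≤ b i - a i)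
    (hP : Continuous P) (hP' : ∀ i, Continuous (P' i))
    (hd : ∀ i v, HasDerivAt (fun t => P (Function.update v i t)) (P' i v) (v i))
    (hle : ∀ i, ∀ v ∈ Icc a b, ‖P' i v‖ ≤ 1) :
    ∫⁻ v in Icc a b, ‖f (P v)‖ₑ ^ (6 : ℝ) ≤
      8 ^ 6 * (∫⁻ v in Icc a b, (‖f (P v)‖ₑ + ‖fderiv ℝ f (P v)‖ₑ) ^ (2 : ℝ)) ^ (3 : ℝ) := by
  have hf' := hf.continuous_fderiv one_ne_zero
  have := lintegral_Icc_enorm_rpow_six_le (F := fun v => f (P v))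
    (G := fun v => ‖fderiv ℝ f (P v)‖) (D := fun i v => fderiv ℝ f (P v) (P' i v)) hab
    (hf.continuous.comp hP) (hf'.comp hP).norm
    (fun i => (hf'.comp hP).clm_apply (hP' i))
    (fun i v => (hf.differentiable one_ne_zero _).hasFDerivAt.comp_hasDerivAt_of_eq _ (hd i v)
      (by simp))
    (fun i v hv => ((fderiv ℝ f _).le_opNorm _).trans
      (mul_le_of_le_one_right (norm_nonneg _) (hle i v hv)))
  simpa only [enorm_norm] using this

theorem lintegral_inner_enorm_rpow_six_le {f : E3 → ℝ} (hf : ContDiff ℝ 1 f) (z : ℝ) :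
    ∫⁻ x in cyl z ∩ {x | rr x < 1 / 2}, ‖f x‖ₑ ^ (6 : ℝ) ≤ 8 ^ 6 * sobolevNorm f z ^ (6 : ℝ) := by
  set a : Fin 3 → ℝ := ![-(1 / 2), -(1 / 2), z - 1]
  set b : Fin 3 → ℝ := ![1 / 2, 1 / 2, z + 1]
  have hpre : ∀ (Φ : E3 → ℝ≥0∞) (S : Set E3), ∫⁻ v in WithLp.toLp 2 ⁻¹' S, Φ (WithLp.toLp 2 v) =
      ∫⁻ x in S, Φ x := fun Φ S =>
    (PiLp.volume_preserving_toLp (Fin 3)).setLIntegral_comp_preimage_emb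
      (MeasurableEquiv.toLp 2 (Fin 3 → ℝ)).measurableEmbedding Φ S
  have hS := lintegral_Icc_comp_enorm_rpow_six_le hf (P := WithLp.toLp 2)
    (P' := fun i _ => EuclideanSpace.single i 1) (a := a) (b := b)
    (fun i => by fin_cases i <;> norm_num [a, b])
    (PiLp.continuous_toLp 2 _) (fun i => continuous_const)
    (fun i v => ((PiLp.continuousLinearEquiv 2 ℝ fun _ : Fin 3 => ℝ).symm.hasFDerivAt).comp_hasDerivAt
      _ (hasDerivAt_update v i (v i)))
    (fun i v _ => by simp)
  rw [← hpre]
  refine (lintegral_mono_set ?_).trans (hS.trans ?_)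
  · intro v hv
    obtain ⟨⟨-, h2⟩, h1⟩ := hv
    change √(v 0 ^ 2 + v 1 ^ 2) < 1 / 2 at h1
    rw [Real.sqrt_lt' (by norm_num)] at h1
    have h3 := abs_le_of_sq_le_sq (by nlinarith [sq_nonneg (v 1)] : v 0 ^ 2 ≤ (1 / 2) ^ 2)
      (by norm_num)
    have h4 := abs_le_of_sq_le_sq (by nlinarith [sq_nonneg (v 0)] : v 1 ^ 2 ≤ (1 / 2) ^ 2)
      (by norm_num)
    rw [abs_le] at h3 h4
    constructor <;> intro i <;> fin_cases i
    exacts [h3.1, h4.1, h2.1, h3.2, h4.2, h2.2]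
  · rw [sobolevNorm, ← ENNReal.rpow_mul, show (1 / 2 : ℝ) * 6 = 3 by norm_num,
      ← hpre (fun x => (‖f x‖ₑ + ‖fderiv ℝ f x‖ₑ) ^ (2 : ℝ))]
    gcongr
    intro v hv
    have h0 := hv.1 0
    have h1 := hv.1 1
    have h0' := hv.2 0
    have h1' := hv.2 1
    refine ⟨?_, hv.1 2, hv.2 2⟩
    change √(v 0 ^ 2 + v 1 ^ 2) ≤ 1
    rw [Real.sqrt_le_one]
    simp only [a, b, Matrix.cons_val_zero, Matrix.cons_val_one] at h0 h1 h0' h1'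
    nlinarith

theorem lintegral_outer_enorm_rpow_six_le {f : E3 → ℝ} (hf : ContDiff ℝ 1 f) (z : ℝ) :
    ∫⁻ x in cyl z ∩ {x | 1 / 2 ≤ rr x}, ‖f x‖ₑ ^ (6 : ℝ) ≤
      8 ^ 7 * sobolevNorm f z ^ (6 : ℝ) := by
  have hfc := hf.continuous
  have hf' := hf.continuous_fderiv one_ne_zero
  have hmP := continuous_cylPolar.measurable
  have hmf := hfc.measurable
  have hmf' := hf'.measurable
  set a : Fin 3 → ℝ := ![1 / 2, -π, z - 1]
  set b : Fin 3 → ℝ := ![1, π, z + 1]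
  have hS := lintegral_Icc_comp_enorm_rpow_six_le hf (P := cylPolar) (P' := cylPolarDeriv)
    (a := a) (b := b)
    (fun i => by
      have := Real.pi_gt_three
      fin_cases i <;> simp [a, b] <;> linarith)
    continuous_cylPolar continuous_cylPolarDeriv hasDerivAt_cylPolar_update
    (fun i v hv => norm_cylPolarDeriv_le i (by
      have h0 := hv.1 0
      have h1 := hv.2 0
      simp only [a, b, Matrix.cons_val_zero] at h0 h1
      exact abs_le.2 ⟨by linarith, h1⟩))
  have hmeas : MeasurableSet {x : E3 | 1 / 2 ≤ rr x} :=
    measurableSet_le measurable_const continuous_rr.measurable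
  have hsob : ∫⁻ v in Icc a b, (‖f (cylPolar v)‖ₑ + ‖fderiv ℝ f (cylPolar v)‖ₑ) ^ (2 : ℝ) ≤
      2 * sobolevNorm f z ^ (2 : ℝ) := by
    rw [sobolevNorm, ← ENNReal.rpow_mul, show (1 / 2 : ℝ) * 2 = 1 by norm_num, ENNReal.rpow_one,
      lintegral_cyl z (by fun_prop), ← lintegral_const_mul _ (by fun_prop)]
    have hae : (univ.pi fun i => Ioo (a i) (b i)) =ᵐ[volume] Icc a b :=
      Measure.univ_pi_Ioo_ae_eq_Icc
    rw [← setLIntegral_congr hae]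
    have hsub : (univ.pi fun i => Ioo (a i) (b i)) ⊆ cylBox z := by
      intro v hv
      have h0 : v 0 ∈ Ioo (1 / 2 : ℝ) 1 := hv 0 (mem_univ _)
      have h1 : v 1 ∈ Ioo (-π) π := hv 1 (mem_univ _)
      have h2 : v 2 ∈ Ioo (z - 1) (z + 1) := hv 2 (mem_univ _)
      exact ⟨⟨by linarith [h0.1], h0.2.le⟩, h1, Ioo_subset_Icc_self h2⟩
    refine le_trans (setLIntegral_mono' (MeasurableSet.univ_pi fun i => measurableSet_Ioo)
      fun v hv => ?_) (lintegral_mono_set hsub)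
    have h0 : v 0 ∈ Ioo (1 / 2 : ℝ) 1 := hv 0 (mem_univ _)
    rw [← mul_assoc]
    refine le_mul_of_one_le_left' ?_
    rw [show (2 : ℝ≥0∞) = ENNReal.ofReal 2 by simp, ← ENNReal.ofReal_mul (by norm_num),
      ENNReal.one_le_ofReal]
    linarith [h0.1]
  calc ∫⁻ x in cyl z ∩ {x | 1 / 2 ≤ rr x}, ‖f x‖ₑ ^ (6 : ℝ)
      = ∫⁻ x in cyl z, {x | 1 / 2 ≤ rr x}.indicator (fun x => ‖f x‖ₑ ^ (6 : ℝ)) x := by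
        rw [setLIntegral_indicator hmeas, inter_comm]
    _ = ∫⁻ v in cylBox z, ENNReal.ofReal (v 0) *
          {x | 1 / 2 ≤ rr x}.indicator (fun x => ‖f x‖ₑ ^ (6 : ℝ)) (cylPolar v) :=
        lintegral_cyl z (Measurable.indicator (by fun_prop) hmeas)
    _ ≤ ∫⁻ v in Icc a b, ‖f (cylPolar v)‖ₑ ^ (6 : ℝ) := by
        rw [← lintegral_indicator (measurableSet_cylBox z), ← lintegral_indicator measurableSet_Icc]
        refine lintegral_mono fun v => ?_
        by_cases hv : v ∈ cylBox z
        · rw [indicator_of_mem hv]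
          have hr := rr_cylPolar hv.1.1.le
          by_cases h2 : 1 / 2 ≤ v 0
          · have hm : v ∈ Icc a b := by
              obtain ⟨h0, h1, h2'⟩ := hv
              constructor <;> intro i <;> fin_cases i
              exacts [h2, h1.1.le, h2'.1, h0.2, h1.2.le, h2'.2]
            rw [indicator_of_mem hm, indicator_of_mem (by simpa [hr] using h2)]
            exact mul_le_of_le_one_left' (by simpa using hv.1.2)
          · rw [indicator_of_notMem (by simpa [hr] using h2)]
            simp
        · rw [indicator_of_notMem hv]
          exact zero_le
    _ ≤ _ := hS
    _ ≤ 8 ^ 6 * (2 * sobolevNorm f z ^ (2 : ℝ)) ^ (3 : ℝ) := by gcongr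
    _ = _ := by
        rw [ENNReal.mul_rpow_of_nonneg _ _ (by norm_num), ← ENNReal.rpow_mul, ← mul_assoc]
        norm_num

theorem hardyEnergy_six_le {f : E3 → ℝ} (hf : ContDiff ℝ 1 f) (z : ℝ) :
    hardyEnergy f z 6 ≤ (16 * sobolevNorm f z) ^ (6 : ℝ) := by
  have h : hardyEnergy f z 6 = ∫⁻ x in cyl z, ‖f x‖ₑ ^ (6 : ℝ) := by
    rw [hardyEnergy]
    refine lintegral_congr fun x => ?_
    norm_num
  have hsub : cyl z ⊆ (cyl z ∩ {x | rr x < 1 / 2}) ∪ (cyl z ∩ {x | 1 / 2 ≤ rr x}) := by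
    intro x hx
    rcases lt_or_ge (rr x) (1 / 2) with h | h
    exacts [Or.inl ⟨hx, h⟩, Or.inr ⟨hx, h⟩]
  rw [h]
  calc _ ≤ _ := lintegral_mono_set hsub
    _ ≤ _ := lintegral_union_le _ _ _
    _ ≤ 8 ^ 6 * sobolevNorm f z ^ (6 : ℝ) + 8 ^ 7 * sobolevNorm f z ^ (6 : ℝ) :=
        add_le_add (lintegral_inner_enorm_rpow_six_le hf z) (lintegral_outer_enorm_rpow_six_le hf z)
    _ = (8 ^ 6 + 8 ^ 7) * sobolevNorm f z ^ (6 : ℝ) := by ring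
    _ ≤ 16 ^ (6 : ℝ) * sobolevNorm f z ^ (6 : ℝ) := by
        gcongr
        norm_num
    _ = _ := (ENNReal.mul_rpow_of_nonneg _ _ (by norm_num)).symm

theorem hardyEnergy_interpolate {f : E3 → ℝ} (hf : ContDiff ℝ 1 f) (z : ℝ)
    {p t : ℝ} (hp : 0 ≤ p) (ht : 0 ≤ t) (ht1 : t ≤ 1) :
    hardyEnergy f z ((1 - t) * p + t * 6) ≤
      hardyEnergy f z p ^ (1 - t) * hardyEnergy f z 6 ^ t := by
  have hfc := hf.continuous
  have hmr := continuous_rr.measurable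
  have := ENNReal.lintegral_mul_norm_pow_le (μ := volume.restrict (cyl z))
    (f := fun x => ENNReal.ofReal (rr x) ^ (p / 2 - 3) * ‖f x‖ₑ ^ p)
    (g := fun x => ENNReal.ofReal (rr x) ^ ((6 : ℝ) / 2 - 3) * ‖f x‖ₑ ^ (6 : ℝ))
    (by fun_prop) (by fun_prop) (sub_nonneg.2 ht1) ht (by ring)
  refine le_trans (le_of_eq ?_) this
  rw [hardyEnergy]
  refine lintegral_congr fun x => ?_
  rw [show (6 : ℝ) / 2 - 3 = 0 by norm_num, ENNReal.rpow_zero, one_mul,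
    ENNReal.mul_rpow_of_nonneg _ _ (sub_nonneg.2 ht1), ← ENNReal.rpow_mul, ← ENNReal.rpow_mul,
    ← ENNReal.rpow_mul, mul_assoc, ← ENNReal.rpow_add_of_nonneg _ _
      (mul_nonneg hp (sub_nonneg.2 ht1)) (by positivity)]
  ring_nf

theorem hardyEnergy_rpow_le_of_le_four {f : E3 → ℝ} (hf : ContDiff ℝ 1 f) (z : ℝ) {p : ℝ}
    (hp : 2 < p) (hp4 : p ≤ 4) :
    hardyEnergy f z p ≤ (ENNReal.ofReal (16 / (p / 2 - 1)) * sobolevNorm f z) ^ p := by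
  set I := hardyEnergy f z p with hI
  set M := ENNReal.ofReal (16 / (p / 2 - 1)) * sobolevNorm f z with hM
  have hb : 0 < p / 2 - 1 := by linarith
  set t := (p - 2) / (6 - p) with ht
  have ht0 : 0 ≤ t := div_nonneg (by linarith) (by linarith)
  have ht1 : t ≤ 1 := (div_le_one (by linarith)).2 (by linarith)
  have htp : t * (6 - p) = p - 2 := div_mul_cancel₀ _ (by linarith)
  rcases eq_or_ne I 0 with h0 | h0
  · rw [h0]; exact zero_le
  have hfin : I ≠ ⊤ := hardyEnergy_ne_top hf z hp
  have h1 : I ≤ M * hardyEnergy f z (2 * p - 2) ^ (1 / 2 : ℝ) := by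
    have h := ofReal_mul_hardyEnergy_le hf z hp hp4
    calc I = ENNReal.ofReal (1 / (p / 2 - 1)) * (ENNReal.ofReal (p / 2 - 1) * I) := by
          rw [← mul_assoc, ← ENNReal.ofReal_mul (by positivity), one_div_mul_cancel hb.ne']
          simp
      _ ≤ ENNReal.ofReal (1 / (p / 2 - 1)) *
          (6 * (sobolevNorm f z * hardyEnergy f z (2 * p - 2) ^ (1 / 2 : ℝ))) := by gcongr
      _ = (ENNReal.ofReal (1 / (p / 2 - 1)) * ENNReal.ofReal 6) * sobolevNorm f z *
          hardyEnergy f z (2 * p - 2) ^ (1 / 2 : ℝ) := by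
          rw [ENNReal.ofReal_ofNat]
          ring
      _ ≤ _ := by
          rw [hM, ← ENNReal.ofReal_mul (by positivity)]
          gcongr
          rw [div_mul_eq_mul_div]
          gcongr
          norm_num
  have h6 : hardyEnergy f z 6 ≤ M ^ (6 : ℝ) := by
    refine (hardyEnergy_six_le hf z).trans ?_
    rw [hM]
    gcongr
    rw [show (16 : ℝ≥0∞) = ENNReal.ofReal 16 by simp]
    refine ENNReal.ofReal_le_ofReal ?_
    rw [le_div_iff₀ hb]
    linarith
  have h2 : hardyEnergy f z (2 * p - 2) ≤ I ^ (1 - t) * (M ^ (6 : ℝ)) ^ t := by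
    have h := hardyEnergy_interpolate hf z (by linarith : 0 ≤ p) ht0 ht1
    rw [show (1 - t) * p + t * 6 = 2 * p - 2 by linarith] at h
    refine h.trans ?_
    gcongr
  have h3 : I ^ ((1 + t) / 2) ≤ M ^ (1 + 3 * t) := by
    have hne : I ^ ((1 - t) / 2) ≠ 0 := by
      simp [ENNReal.rpow_eq_zero_iff, h0, hfin]
    have hnt : I ^ ((1 - t) / 2) ≠ ⊤ :=
      ENNReal.rpow_ne_top_of_nonneg (by linarith) hfin
    refine (ENNReal.mul_le_mul_iff_right hne hnt).1 ?_
    calc I ^ ((1 - t) / 2) * I ^ ((1 + t) / 2) = I := by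
          rw [← ENNReal.rpow_add _ _ h0 hfin, ← add_div]
          norm_num
      _ ≤ M * (I ^ (1 - t) * (M ^ (6 : ℝ)) ^ t) ^ (1 / 2 : ℝ) := h1.trans (by gcongr)
      _ = I ^ ((1 - t) / 2) * (M ^ (1 : ℝ) * M ^ (3 * t)) := by
          rw [ENNReal.mul_rpow_of_nonneg _ _ (by norm_num), ← ENNReal.rpow_mul,
            ← ENNReal.rpow_mul, ← ENNReal.rpow_mul, ENNReal.rpow_one]
          ring_nf
      _ = _ := by rw [← ENNReal.rpow_add_of_nonneg _ _ (by norm_num) (by positivity)]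
  have ht2 : 1 + t ≠ 0 := by linarith
  calc I = (I ^ ((1 + t) / 2)) ^ (2 / (1 + t)) := by
        rw [← ENNReal.rpow_mul, div_mul_div_cancel₀ two_ne_zero, div_self ht2, ENNReal.rpow_one]
    _ ≤ (M ^ (1 + 3 * t)) ^ (2 / (1 + t)) := by gcongr
    _ = M ^ p := by
        rw [← ENNReal.rpow_mul]
        congr 1
        field_simp
        linarith

theorem hardyEnergy_rpow_le_of_four_le {f : E3 → ℝ} (hf : ContDiff ℝ 1 f) (z : ℝ) {p : ℝ}
    (hp : 4 ≤ p) (hp6 : p ≤ 6) :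
    hardyEnergy f z p ≤ (16 * sobolevNorm f z) ^ p := by
  have h4 := hardyEnergy_rpow_le_of_le_four hf z (by norm_num : (2 : ℝ) < 4) le_rfl
  norm_num only [div_one, ENNReal.ofReal_ofNat] at h4
  have h := hardyEnergy_interpolate hf z (by norm_num : (0 : ℝ) ≤ 4)
    (by linarith : 0 ≤ (p - 4) / 2) (by linarith)
  rw [show (1 - (p - 4) / 2) * 4 + (p - 4) / 2 * 6 = p by ring] at h
  calc _ ≤ _ := h
    _ ≤ ((16 * sobolevNorm f z) ^ (4 : ℝ)) ^ (1 - (p - 4) / 2) *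
        ((16 * sobolevNorm f z) ^ (6 : ℝ)) ^ ((p - 4) / 2) := by
        gcongr
        · linarith
        · exact hardyEnergy_six_le hf z
    _ = _ := by
        rw [← ENNReal.rpow_mul, ← ENNReal.rpow_mul,
          ← ENNReal.rpow_add_of_nonneg _ _ (by linarith) (by linarith)]
        ring_nf

theorem hardyEnergy_rpow_le {f : E3 → ℝ} (hf : ContDiff ℝ 1 f) (z : ℝ) {p : ℝ}
    (hp : 2 < p) (hp6 : p ≤ 6) :
    hardyEnergy f z p ≤ (ENNReal.ofReal (64 / (p - 2)) * sobolevNorm f z) ^ p := by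
  rcases le_total p 4 with h | h
  · refine (hardyEnergy_rpow_le_of_le_four hf z hp h).trans ?_
    gcongr ?_ ^ p
    gcongr ENNReal.ofReal ?_ * _
    rw [div_le_div_iff₀ (by linarith) (by linarith)]
    linarith
  · refine (hardyEnergy_rpow_le_of_four_le hf z h hp6).trans ?_
    rw [show (16 : ℝ≥0∞) = ENNReal.ofReal 16 by simp]
    gcongr ?_ ^ p
    gcongr ENNReal.ofReal ?_ * _
    rw [le_div_iff₀ (by linarith)]
    linarith

theorem ball_inter_subset_cyl (x₀ : E3) : ball x₀ 1 ∩ {x | rr x ≤ 1} ⊆ cyl (x₀ 2) := by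
  rintro x ⟨hx, hr⟩
  refine ⟨hr, ?_⟩
  have h := (PiLp.norm_apply_le (x - x₀) 2).trans (mem_ball_iff_norm.1 hx).le
  rw [PiLp.sub_apply, Real.norm_eq_abs, abs_le] at h
  constructor <;> linarith [h.1, h.2]

theorem exists_lintegral_cyl_le :
    ∃ N : ℕ, ∀ (z : ℝ) (h : E3 → ℝ≥0∞) (A : ℝ≥0∞),
      (∀ x₀, ∫⁻ x in ball x₀ 1 ∩ {x | rr x ≤ 1}, h x ≤ A) → ∫⁻ x in cyl z, h x ≤ N * A := by
  obtain ⟨t, -, ht, hcover⟩ := (isCompact_closedBall (0 : E3) 2).finite_cover_balls one_pos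
  have := ht.fintype
  refine ⟨Fintype.card t, fun z h A hA => ?_⟩
  set e : E3 := EuclideanSpace.single 2 z
  have hsub : cyl z ⊆ ⋃ c : t, ball (c.1 + e) 1 ∩ {x | rr x ≤ 1} := by
    intro x hx
    have hmem : x - e ∈ closedBall (0 : E3) 2 := by
      rw [mem_closedBall_zero_iff, EuclideanSpace.norm_eq, Real.sqrt_le_left (by norm_num)]
      have h1 : x 0 ^ 2 + x 1 ^ 2 ≤ 1 := Real.sqrt_le_one.1 hx.1
      have h2 := hx.2.1
      have h3 := hx.2.2
      simp [Fin.sum_univ_three, e]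
      nlinarith
    obtain ⟨c, hc, hxc⟩ := mem_iUnion₂.1 (hcover hmem)
    refine mem_iUnion.2 ⟨⟨c, hc⟩, ?_, hx.1⟩
    rw [mem_ball_iff_norm] at hxc ⊢
    rwa [sub_add_eq_sub_sub_swap]
  calc _ ≤ _ := lintegral_mono_set hsub
    _ ≤ _ := lintegral_iUnion_le _ _
    _ ≤ ∑' _ : t, A := ENNReal.tsum_le_tsum fun c => hA _
    _ = _ := by simp [tsum_fintype]

theorem eLpNorm_two_eq {F : Type*} [NormedAddCommGroup F] (g : E3 → F) (μ : Measure E3) :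
    eLpNorm g 2 μ = (∫⁻ x, ‖g x‖ₑ ^ (2 : ℝ) ∂μ) ^ (1 / 2 : ℝ) := by
  rw [eLpNorm_eq_lintegral_rpow_enorm_toReal two_ne_zero ENNReal.ofNat_ne_top]
  simp

theorem exists_eLpNorm_cyl_le :
    ∃ N : ℝ, 0 < N ∧ ∀ (z : ℝ) {F : Type} [NormedAddCommGroup F] (g : E3 → F),
      eLpNorm g 2 (volume.restrict (cyl z)) ≤ ENNReal.ofReal N *
        ⨆ x₀, eLpNorm g 2 (volume.restrict (ball x₀ 1 ∩ {x | rr x ≤ 1})) := by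
  obtain ⟨N, hN⟩ := exists_lintegral_cyl_le
  refine ⟨((N : ℝ) + 1) ^ (1 / 2 : ℝ), by positivity, fun z F _ g => ?_⟩
  set S := ⨆ x₀, eLpNorm g 2 (volume.restrict (ball x₀ 1 ∩ {x | rr x ≤ 1})) with hS
  have h := hN z (fun x => ‖g x‖ₑ ^ (2 : ℝ)) (S ^ (2 : ℝ)) fun x₀ => by
    have hle : eLpNorm g 2 (volume.restrict (ball x₀ 1 ∩ {x | rr x ≤ 1})) ≤ S :=
      le_iSup (fun x₀ => eLpNorm g 2 (volume.restrict (ball x₀ 1 ∩ {x | rr x ≤ 1}))) x₀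
    rw [eLpNorm_two_eq] at hle
    have := ENNReal.rpow_le_rpow hle (by norm_num : (0 : ℝ) ≤ 2)
    rwa [← ENNReal.rpow_mul, one_div_mul_cancel two_ne_zero, ENNReal.rpow_one] at this
  rw [eLpNorm_two_eq]
  calc _ ≤ (N * S ^ (2 : ℝ)) ^ (1 / 2 : ℝ) := by gcongr
    _ = (N : ℝ≥0∞) ^ (1 / 2 : ℝ) * S := by
        rw [ENNReal.mul_rpow_of_nonneg _ _ (by norm_num), ← ENNReal.rpow_mul,
          mul_one_div_cancel two_ne_zero, ENNReal.rpow_one]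
    _ ≤ _ := by
        rw [← ENNReal.ofReal_rpow_of_pos (by positivity)]
        gcongr
        rw [ENNReal.ofReal_add (by positivity) zero_le_one, ENNReal.ofReal_natCast]
        exact le_self_add

theorem sobolevNorm_le {f : E3 → ℝ} (hf : ContDiff ℝ 1 f) (z : ℝ) :
    sobolevNorm f z ≤ eLpNorm f 2 (volume.restrict (cyl z)) +
      eLpNorm (fun x => fderiv ℝ f x) 2 (volume.restrict (cyl z)) := by
  have hfc := hf.continuous
  have hf' := hf.continuous_fderiv one_ne_zero
  rw [eLpNorm_two_eq, eLpNorm_two_eq, sobolevNorm]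
  exact ENNReal.lintegral_Lp_add_le (f := fun x => ‖f x‖ₑ) (g := fun x => ‖fderiv ℝ f x‖ₑ)
    (by fun_prop) (by fun_prop) one_le_two

theorem eLpNorm_rr_rpow_mul_le (f : E3 → ℝ) (z : ℝ) {p : ℝ} (hp : 0 < p) :
    eLpNorm (fun x => rr x ^ (-3 / p + 1 / 2) * f x) (ENNReal.ofReal p)
      (volume.restrict (cyl z)) ≤ hardyEnergy f z p ^ (1 / p) := by
  rw [eLpNorm_eq_lintegral_rpow_enorm_toReal (by simpa using hp) ENNReal.ofReal_ne_top,
    ENNReal.toReal_ofReal hp.le, hardyEnergy]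
  gcongr with x
  have hr : 0 ≤ rr x := Real.sqrt_nonneg _
  rw [enorm_mul, ENNReal.mul_rpow_of_nonneg _ _ hp.le]
  gcongr
  rw [show p / 2 - 3 = (-3 / p + 1 / 2) * p by field_simp; ring, ENNReal.rpow_mul]
  gcongr
  rw [enorm_of_nonneg (Real.rpow_nonneg hr _)]
  rcases hr.eq_or_lt with h | h
  · rw [← h]
    generalize -3 / p + 1 / 2 = a
    rcases lt_trichotomy a 0 with h1 | rfl | h1
    · simp [ENNReal.zero_rpow_of_neg h1]
    · simp
    · simp [Real.zero_rpow h1.ne']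
  · rw [ENNReal.ofReal_rpow_of_pos h]

/-- Quantified Hardy inequality, uniformly-local version. -/
theorem stmt11 (ε : ℝ) (hε : ε ∈ Set.Ioo (0:ℝ) 1) :
    ∃ Cε K : ℝ, 0 < Cε ∧ 0 < K ∧
      ∀ p : ℝ, 2 < p → p < 6 - ε →
        ∀ f : E3 → ℝ, ContDiff ℝ 1 f →
          (⨆ x₀ : E3, eLpNorm f 2
              (volume.restrict (Metric.ball x₀ 1 ∩ {x : E3 | rr x ≤ 1}))) < ⊤ →
          (⨆ x₀ : E3, eLpNorm (fun x => fderiv ℝ f x) 2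
              (volume.restrict (Metric.ball x₀ 1 ∩ {x : E3 | rr x ≤ 1}))) < ⊤ →
          (⨆ x₀ : E3, eLpNorm (fun x => rr x ^ (-3 / p + 1/2) * f x) (ENNReal.ofReal p)
              (volume.restrict (Metric.ball x₀ 1 ∩ {x : E3 | rr x ≤ 1}))) ≤
            ENNReal.ofReal (Cε * (p - 2) ^ (-K)) *
              ((⨆ x₀ : E3, eLpNorm f 2
                  (volume.restrict (Metric.ball x₀ 1 ∩ {x : E3 | rr x ≤ 1}))) +
               (⨆ x₀ : E3, eLpNorm (fun x => fderiv ℝ f x) 2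
                  (volume.restrict (Metric.ball x₀ 1 ∩ {x : E3 | rr x ≤ 1})))) := by
  obtain ⟨N, hN, hcyl⟩ := exists_eLpNorm_cyl_le
  refine ⟨64 * N, 1, by positivity, one_pos, fun p hp hp6 f hf _ _ => iSup_le fun x₀ => ?_⟩
  have hp0 : 0 < p := by linarith
  have hp2 : 0 < p - 2 := by linarith
  set S := ⨆ x₀ : E3, eLpNorm f 2 (volume.restrict (Metric.ball x₀ 1 ∩ {x : E3 | rr x ≤ 1}))
  set S' := ⨆ x₀ : E3, eLpNorm (fun x => fderiv ℝ f x) 2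
    (volume.restrict (Metric.ball x₀ 1 ∩ {x : E3 | rr x ≤ 1}))
  calc _ ≤ eLpNorm (fun x => rr x ^ (-3 / p + 1 / 2) * f x) (ENNReal.ofReal p)
        (volume.restrict (cyl (x₀ 2))) :=
        eLpNorm_mono_measure _ (Measure.restrict_mono_set _ (ball_inter_subset_cyl x₀))
    _ ≤ hardyEnergy f (x₀ 2) p ^ (1 / p) := eLpNorm_rr_rpow_mul_le f _ hp0
    _ ≤ ((ENNReal.ofReal (64 / (p - 2)) * sobolevNorm f (x₀ 2)) ^ p) ^ (1 / p) := by
        gcongr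
        exact hardyEnergy_rpow_le hf _ hp (by linarith [hε.1])
    _ = ENNReal.ofReal (64 / (p - 2)) * sobolevNorm f (x₀ 2) := by
        rw [← ENNReal.rpow_mul, mul_one_div_cancel hp0.ne', ENNReal.rpow_one]
    _ ≤ ENNReal.ofReal (64 / (p - 2)) * (ENNReal.ofReal N * S + ENNReal.ofReal N * S') := by
        gcongr
        exact (sobolevNorm_le hf _).trans (add_le_add (hcyl _ _) (hcyl _ _))
    _ = ENNReal.ofReal (64 * N * (p - 2) ^ (-1 : ℝ)) * (S + S') := by
        rw [← mul_add, ← mul_assoc, ← ENNReal.ofReal_mul (by positivity), Real.rpow_neg_one]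
        ring_nf
end
end

section
/- Fix i ∈ {1,2} and a, b ∈ {1,2,3}. There exists an absolute constant C > 0 such that for every Schwartz function Γ : ℝ³ → ℝ, the function f(x) := ∂_a∂_b ∫_{ℝ³} (1/(4π|x−y|)) ∂_iΓ(y) dy (the second derivative of the Newtonian potential of ∂_iΓ, i.e. f = ∂_a∂_b(−Δ)^{−1}∂_iΓ) satisfies ‖f‖_{L²_{3-uloc}} ≤ C·( ‖Γ‖_{L²_{3-uloc}} + ‖∂_iΓ‖_{L²_{3-uloc}} ). -/
noncomputable section
open Real MeasureTheory Filter Metric Set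
open scoped ENNReal NNReal Topology FourierTransform

/-- The `x₃`-uniformly-local `L^p` norm over a region `Ω`. -/
def uloc3On {F : Type*} [NormedAddCommGroup F] (g : E3 → F) (p : ℝ≥0∞) (Ω : Set E3) : ℝ≥0∞ :=
  ⨆ z : ℝ, eLpNorm g p (volume.restrict (Ω ∩ {x : E3 | x 2 ∈ Set.Icc (z - 1) (z + 1)}))

/-- The `x₃`-uniformly-local `L^p` norm. -/
def uloc3 {F : Type*} [NormedAddCommGroup F] (g : E3 → F) (p : ℝ≥0∞) : ℝ≥0∞ :=
  uloc3On g p Set.univ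

/-- The decaying weight `(1 + ‖x‖)⁻⁴`, integrable on `ℝ³`. -/
def decayWeight (x : E3) : ℝ := ((1 + ‖x‖) ^ 4)⁻¹

/-- The convolution `x ↦ ∫ K(y) h(x - y) dy`. -/
def conv (K h : E3 → ℝ) (x : E3) : ℝ := ∫ y, K y * h (x - y)

/-- The partial derivative of a Schwartz function. -/
def sd (c : Fin 3) (h : SchwartzMap E3 ℝ) : SchwartzMap E3 ℝ :=
  LineDeriv.lineDerivOp (EuclideanSpace.single c (1 : ℝ)) h

lemma sd_apply (c : Fin 3) (h : SchwartzMap E3 ℝ) (x : E3) :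
    sd c h x = fderiv ℝ h x (EuclideanSpace.single c 1) := rfl

lemma decayWeight_pos (x : E3) : 0 < decayWeight x := by
  unfold decayWeight; positivity

lemma integrable_decayWeight : Integrable decayWeight := by
  have h := integrable_one_add_norm (μ := (volume : Measure E3)) (r := 4) (by simp; norm_num)
  refine h.congr (Eventually.of_forall fun x => ?_)
  simp only [decayWeight]
  rw [Real.rpow_neg (by positivity)]
  norm_cast

lemma decayWeight_sub_le (x y : E3) :
    decayWeight (x - y) ≤ (1 + ‖x‖) ^ 4 * decayWeight y := by
  unfold decayWeight
  rw [← div_eq_mul_inv, inv_eq_one_div, div_le_div_iff₀ (by positivity) (by positivity), one_mul,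
    ← mul_pow]
  gcongr
  have : ‖y‖ ≤ ‖x‖ + ‖x - y‖ := by
    have := norm_sub_le x (x - y)
    simpa using this
  nlinarith [norm_nonneg x, norm_nonneg (x - y), mul_nonneg (norm_nonneg x) (norm_nonneg (x - y))]

lemma SchwartzMap.exists_norm_le_decayWeight {F : Type*} [NormedAddCommGroup F] [NormedSpace ℝ F]
    (h : SchwartzMap E3 F) : ∃ C, 0 ≤ C ∧ ∀ x, ‖h x‖ ≤ C * decayWeight x := by
  refine ⟨2 ^ 4 * ((Finset.Iic (4, 0)).sup fun m => SchwartzMap.seminorm ℝ m.1 m.2) h,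
    by positivity, fun x => ?_⟩
  have := SchwartzMap.one_add_le_sup_seminorm_apply (𝕜 := ℝ) (m := (4, 0)) (k := 4) (n := 0)
    le_rfl le_rfl h x
  rw [norm_iteratedFDeriv_zero] at this
  unfold decayWeight
  rw [← div_eq_mul_inv, le_div_iff₀ (by positivity), mul_comm]
  exact this

/-- Kernels that can be convolved with every Schwartz function. -/
def Tame (K : E3 → ℝ) : Prop :=
  AEStronglyMeasurable K ∧ Integrable fun y => K y * decayWeight y

lemma Tame.of_bounded {K : E3 → ℝ} (hK : Continuous K) {C : ℝ} (hC : ∀ y, |K y| ≤ C) : Tame K :=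
  ⟨hK.aestronglyMeasurable,
    integrable_decayWeight.bdd_mul hK.aestronglyMeasurable (Eventually.of_forall hC)⟩

lemma Tame.integrable_mul {F : Type*} [NormedAddCommGroup F] [NormedSpace ℝ F] {K : E3 → ℝ}
    (hK : Tame K) (h : SchwartzMap E3 F) (x : E3) :
    Integrable fun y => K y • h (x - y) := by
  obtain ⟨C, hC, hh⟩ := h.exists_norm_le_decayWeight
  refine (hK.2.norm.const_mul (C * (1 + ‖x‖) ^ 4)).mono'
    (hK.1.smul (by fun_prop)) (Eventually.of_forall fun y => ?_)
  rw [norm_smul, norm_mul, Real.norm_of_nonneg (decayWeight_pos y).le]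
  calc ‖K y‖ * ‖h (x - y)‖ ≤ ‖K y‖ * (C * ((1 + ‖x‖) ^ 4 * decayWeight y)) := by
        gcongr
        exact (hh _).trans (mul_le_mul_of_nonneg_left (decayWeight_sub_le x y) hC)
    _ = _ := by ring

lemma Tame.hasFDerivAt_conv {K : E3 → ℝ} (hK : Tame K) (h : SchwartzMap E3 ℝ) (x : E3) :
    HasFDerivAt (conv K h) (∫ y, K y • SchwartzMap.fderivCLM ℝ E3 ℝ h (x - y)) x := by
  obtain ⟨C, hC, hh⟩ := (SchwartzMap.fderivCLM ℝ E3 ℝ h).exists_norm_le_decayWeight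
  refine hasFDerivAt_integral_of_dominated_of_fderiv_le
    (F := fun x y => K y * h (x - y))
    (F' := fun x y => K y • SchwartzMap.fderivCLM ℝ E3 ℝ h (x - y))
    (bound := fun y => C * (2 + ‖x‖) ^ 4 * ‖K y * decayWeight y‖)
    (s := ball x 1) (ball_mem_nhds x one_pos) ?_ ?_ ?_ ?_ ?_ ?_
  · exact Eventually.of_forall fun z => (hK.integrable_mul h z).1
  · exact hK.integrable_mul h x
  · exact (hK.integrable_mul (SchwartzMap.fderivCLM ℝ E3 ℝ h) x).1
  · refine Eventually.of_forall fun y z hz => ?_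
    have hz' : ‖z‖ ≤ ‖x‖ + 1 := by
      have := norm_le_norm_add_norm_sub' z x
      rw [mem_ball, dist_eq_norm] at hz
      linarith
    rw [norm_smul, norm_mul, Real.norm_of_nonneg (decayWeight_pos y).le]
    calc ‖K y‖ * ‖SchwartzMap.fderivCLM ℝ E3 ℝ h (z - y)‖
        ≤ ‖K y‖ * (C * ((1 + ‖z‖) ^ 4 * decayWeight y)) := by
          gcongr
          exact (hh _).trans (mul_le_mul_of_nonneg_left (decayWeight_sub_le z y) hC)
      _ ≤ ‖K y‖ * (C * ((2 + ‖x‖) ^ 4 * decayWeight y)) := by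
          have := (decayWeight_pos y).le
          gcongr ‖K y‖ * (C * (?_ ^ 4 * _))
          linarith
      _ = _ := by ring
  · exact hK.2.norm.const_mul _
  · refine Eventually.of_forall fun y z _ => ?_
    have h1 : HasFDerivAt (fun z => h (z - y)) (fderiv ℝ h (z - y)) z := by
      simpa [Function.comp_def] using
          (h.hasFDerivAt (z - y)).comp z ((hasFDerivAt_id z).sub_const y)
    exact h1.const_mul (K y)

lemma Tame.differentiable_conv {K : E3 → ℝ} (hK : Tame K) (h : SchwartzMap E3 ℝ) :
    Differentiable ℝ (conv K h) := fun x => (hK.hasFDerivAt_conv h x).differentiableAt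

lemma Tame.fderiv_conv {K : E3 → ℝ} (hK : Tame K) (h : SchwartzMap E3 ℝ) (c : Fin 3) (x : E3) :
    fderiv ℝ (conv K h) x (EuclideanSpace.single c 1) = conv K (sd c h) x := by
  rw [(hK.hasFDerivAt_conv h x).fderiv,
    ContinuousLinearMap.integral_apply (hK.integrable_mul _ x)]
  rfl

/-- Integration by parts: a derivative falling on the density moves to the kernel. -/
lemma conv_sd {K K' : E3 → ℝ} {c : Fin 3} (hK : Tame K) (hK' : Tame K')
    (hd : ∀ y, HasLineDerivAt ℝ K (K' y) y (EuclideanSpace.single c 1))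
    (h : SchwartzMap E3 ℝ) (x : E3) : conv K (sd c h) x = conv K' h x := by
  have key := integral_bilinear_hasLineDerivAt_right_eq_neg_left_of_integrable
    (μ := (volume : Measure E3)) (f := K) (f' := K') (g := fun y => h (x - y))
    (g' := fun y => - sd c h (x - y)) (v := EuclideanSpace.single c 1)
    (B := ContinuousLinearMap.mul ℝ ℝ) (hK'.integrable_mul h x)
    (by simpa using (hK.integrable_mul (sd c h) x).neg) (hK.integrable_mul h x)
    (fun y _ => hd y) (fun y _ => by
      have h1 : HasFDerivAt (fun y => h (x - y)) (-(fderiv ℝ h (x - y))) y := by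
        simpa [Function.comp_def] using
          (h.hasFDerivAt (x - y)).comp y ((hasFDerivAt_id y).const_sub x)
      simpa [sd_apply] using h1.hasLineDerivAt (EuclideanSpace.single c 1))
  simp only [ContinuousLinearMap.mul_apply', mul_neg, integral_neg, neg_inj] at key
  exact key

/-- The Kronecker delta. -/
def kd (a b : Fin 3) : ℝ := if a = b then 1 else 0

/-- The regularised kernel `(‖y‖² + e)^(-1/2)`. -/
def regKer (e : ℝ) (y : E3) : ℝ := (‖y‖ ^ 2 + e) ^ (-(1 / 2) : ℝ)

/-- First partial derivatives of `regKer`. -/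
def regKer₁ (e : ℝ) (a : Fin 3) (y : E3) : ℝ := -(y a) * (‖y‖ ^ 2 + e) ^ (-(3 / 2) : ℝ)

/-- Second partial derivatives of `regKer`. -/
def regKer₂ (e : ℝ) (a b : Fin 3) (y : E3) : ℝ :=
  -kd a b * (‖y‖ ^ 2 + e) ^ (-(3 / 2) : ℝ) + 3 * (y a * y b) * (‖y‖ ^ 2 + e) ^ (-(5 / 2) : ℝ)

/-- Third partial derivatives of `regKer`. -/
def regKer₃ (e : ℝ) (a b c : Fin 3) (y : E3) : ℝ :=
  3 * (kd a b * y c + kd a c * y b + kd b c * y a) * (‖y‖ ^ 2 + e) ^ (-(5 / 2) : ℝ)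
    - 15 * (y a * y b * y c) * (‖y‖ ^ 2 + e) ^ (-(7 / 2) : ℝ)

lemma hasDerivAt_coord (y : E3) (a c : Fin 3) :
    HasDerivAt (fun t : ℝ => (y + t • EuclideanSpace.single c (1 : ℝ)) a) (kd a c) 0 := by
  have : (fun t : ℝ => (y + t • EuclideanSpace.single c (1 : ℝ)) a) =
      fun t : ℝ => y a + t * kd a c := by
    funext t
    simp [kd]
  rw [this]
  simpa using ((hasDerivAt_id (0 : ℝ)).mul_const (kd a c)).const_add (y a)

lemma hasDerivAt_rpow_line {e : ℝ} (he : 0 < e) (y : E3) (c : Fin 3) (p q : ℝ) (hq : q = p - 1) :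
    HasDerivAt (fun t : ℝ => (‖y + t • EuclideanSpace.single c (1 : ℝ)‖ ^ 2 + e) ^ p)
      (2 * p * y c * (‖y‖ ^ 2 + e) ^ q) 0 := by
  have h1 : HasDerivAt (fun t : ℝ => ‖y + t • EuclideanSpace.single c (1 : ℝ)‖ ^ 2 + e)
      (2 * y c) 0 := by
    have h2 : HasDerivAt (fun t : ℝ => y + t • EuclideanSpace.single c (1 : ℝ))
        (EuclideanSpace.single c (1 : ℝ)) 0 := by
      simpa using ((hasDerivAt_id (0 : ℝ)).smul_const (EuclideanSpace.single c (1 : ℝ))).const_add y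
    have h3 := h2.norm_sq.add_const e
    simpa [EuclideanSpace.inner_single_right] using h3
  have h4 := h1.rpow_const (p := p) (Or.inl (by simp; positivity))
  subst hq
  refine h4.congr_deriv ?_
  rw [zero_smul, add_zero]
  ring

lemma hasLineDerivAt_regKer {e : ℝ} (he : 0 < e) (a : Fin 3) (y : E3) :
    HasLineDerivAt ℝ (regKer e) (regKer₁ e a y) y (EuclideanSpace.single a 1) := by
  have := hasDerivAt_rpow_line he y a (-(1 / 2)) (-(3 / 2)) (by norm_num)
  unfold HasLineDerivAt
  refine this.congr_deriv ?_
  unfold regKer₁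
  ring

lemma hasLineDerivAt_regKer₁ {e : ℝ} (he : 0 < e) (a b : Fin 3) (y : E3) :
    HasLineDerivAt ℝ (regKer₁ e a) (regKer₂ e a b y) y (EuclideanSpace.single b 1) := by
  have h1 := hasDerivAt_rpow_line he y b (-(3 / 2)) (-(5 / 2)) (by norm_num)
  have := (hasDerivAt_coord y a b).neg.mul h1
  unfold HasLineDerivAt
  refine HasDerivAt.congr_deriv (f := fun t : ℝ => _) this ?_
  simp only [regKer₂, Pi.neg_apply, zero_smul, add_zero]
  ring

lemma hasLineDerivAt_regKer₂ {e : ℝ} (he : 0 < e) (a b c : Fin 3) (y : E3) :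
    HasLineDerivAt ℝ (regKer₂ e a b) (regKer₃ e a b c y) y (EuclideanSpace.single c 1) := by
  have h1 := hasDerivAt_rpow_line he y c (-(3 / 2)) (-(5 / 2)) (by norm_num)
  have h2 := hasDerivAt_rpow_line he y c (-(5 / 2)) (-(7 / 2)) (by norm_num)
  have := (h1.const_mul (-kd a b)).add
    ((((hasDerivAt_coord y a c).mul (hasDerivAt_coord y b c)).const_mul 3).mul h2)
  unfold HasLineDerivAt
  refine HasDerivAt.congr_deriv (f := fun t : ℝ => _) this ?_
  simp only [regKer₃, Pi.mul_apply, zero_smul, add_zero]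
  ring

lemma abs_kd_le (a b : Fin 3) : |kd a b| ≤ 1 := by
  unfold kd; split_ifs <;> simp

lemma abs_coord_le {e : ℝ} (he : 0 < e) (y : E3) (a : Fin 3) :
    |y a| ≤ (‖y‖ ^ 2 + e) ^ (1 / 2 : ℝ) := by
  rw [← Real.sqrt_eq_rpow]
  refine Real.le_sqrt_of_sq_le ?_
  rw [sq_abs, EuclideanSpace.real_norm_sq_eq]
  have := Finset.single_le_sum (f := fun i => y i ^ 2) (fun i _ => sq_nonneg _) (Finset.mem_univ a)
  simp only at this
  linarith

lemma abs_regKer₁_le {e : ℝ} (he : 0 < e) (a : Fin 3) (y : E3) :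
    |regKer₁ e a y| ≤ (‖y‖ ^ 2 + e)⁻¹ := by
  have hs : 0 < ‖y‖ ^ 2 + e := by positivity
  have h0 := abs_coord_le he y a
  set s := ‖y‖ ^ 2 + e
  have hp := (Real.rpow_pos_of_pos hs (-(3 / 2))).le
  have e1 : s⁻¹ = s ^ (1 / 2 : ℝ) * s ^ (-(3 / 2) : ℝ) := by
    rw [← Real.rpow_add hs, ← Real.rpow_neg_one]; norm_num
  rw [regKer₁, abs_mul, abs_neg, abs_of_nonneg hp, e1]
  gcongr

lemma abs_regKer₂_le {e : ℝ} (he : 0 < e) (a b : Fin 3) (y : E3) :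
    |regKer₂ e a b y| ≤ 4 * (‖y‖ ^ 2 + e) ^ (-(3 / 2) : ℝ) := by
  have hs : 0 < ‖y‖ ^ 2 + e := by positivity
  have ha := abs_coord_le he y a
  have hb := abs_coord_le he y b
  have hk := abs_kd_le a b
  simp only [regKer₂]
  set s := ‖y‖ ^ 2 + e
  have hp := (Real.rpow_pos_of_pos hs (-(3 / 2))).le
  have hq := (Real.rpow_pos_of_pos hs (-(5 / 2))).le
  have hr := (Real.rpow_pos_of_pos hs (1 / 2)).le
  have e1 : s ^ (-(3 / 2) : ℝ) = s ^ (1 / 2 : ℝ) * s ^ (1 / 2 : ℝ) * s ^ (-(5 / 2) : ℝ) := by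
    rw [← Real.rpow_add hs, ← Real.rpow_add hs]; norm_num
  calc |-kd a b * s ^ (-(3 / 2) : ℝ) + 3 * (y a * y b) * s ^ (-(5 / 2) : ℝ)|
      ≤ |kd a b| * s ^ (-(3 / 2) : ℝ) + 3 * (|y a| * |y b|) * s ^ (-(5 / 2) : ℝ) := by
        refine (abs_add_le _ _).trans (le_of_eq ?_)
        simp only [abs_mul, abs_neg, abs_of_nonneg hp, abs_of_nonneg hq, Nat.abs_ofNat]
    _ ≤ 1 * s ^ (-(3 / 2) : ℝ) + 3 * (s ^ (1 / 2 : ℝ) * s ^ (1 / 2 : ℝ)) * s ^ (-(5 / 2) : ℝ) := by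
        gcongr
    _ = _ := by rw [mul_assoc 3, ← e1]; ring

lemma abs_regKer₃_le {e : ℝ} (he : 0 < e) (a b c : Fin 3) (y : E3) :
    |regKer₃ e a b c y| ≤ 24 * (‖y‖ ^ 2 + e) ^ (-2 : ℝ) := by
  have hs : 0 < ‖y‖ ^ 2 + e := by positivity
  have ha := abs_coord_le he y a
  have hb := abs_coord_le he y b
  have hc := abs_coord_le he y c
  have hk1 := abs_kd_le a b
  have hk2 := abs_kd_le a c
  have hk3 := abs_kd_le b c
  simp only [regKer₃]
  set s := ‖y‖ ^ 2 + e
  have hp := (Real.rpow_pos_of_pos hs (-(7 / 2))).le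
  have hq := (Real.rpow_pos_of_pos hs (-(5 / 2))).le
  have hr := (Real.rpow_pos_of_pos hs (1 / 2)).le
  have e1 : s ^ (-2 : ℝ) = s ^ (1 / 2 : ℝ) * s ^ (-(5 / 2) : ℝ) := by
    rw [← Real.rpow_add hs]; norm_num
  have e2 : s ^ (-2 : ℝ) =
      s ^ (1 / 2 : ℝ) * s ^ (1 / 2 : ℝ) * s ^ (1 / 2 : ℝ) * s ^ (-(7 / 2) : ℝ) := by
    rw [← Real.rpow_add hs, ← Real.rpow_add hs, ← Real.rpow_add hs]; norm_num
  have h1 : |kd a b * y c + kd a c * y b + kd b c * y a| ≤ 3 * s ^ (1 / 2 : ℝ) := by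
    refine (abs_add_three _ _ _).trans ?_
    simp only [abs_mul]
    calc _ ≤ 1 * s ^ (1 / 2 : ℝ) + 1 * s ^ (1 / 2 : ℝ) + 1 * s ^ (1 / 2 : ℝ) := by gcongr
      _ = _ := by ring
  refine (abs_sub _ _).trans ?_
  simp only [abs_mul, abs_of_nonneg hp, abs_of_nonneg hq, Nat.abs_ofNat]
  calc _ ≤ 3 * (3 * s ^ (1 / 2 : ℝ)) * s ^ (-(5 / 2) : ℝ) +
        15 * (s ^ (1 / 2 : ℝ) * s ^ (1 / 2 : ℝ) * s ^ (1 / 2 : ℝ)) * s ^ (-(7 / 2) : ℝ) := by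
        gcongr
    _ = 9 * s ^ (-2 : ℝ) + 15 * s ^ (-2 : ℝ) := by
        conv_rhs => rw [e2]
        conv_rhs => enter [1]; rw [← e2, e1]
        ring
    _ = _ := by ring

/-- `-Δ` applied to `regKer` is a nonnegative bump of `e`-independent mass. -/
lemma sum_regKer₂ {e : ℝ} (he : 0 < e) (y : E3) :
    ∑ a, regKer₂ e a a y = -(3 * e * (‖y‖ ^ 2 + e) ^ (-(5 / 2) : ℝ)) := by
  have hs : 0 < ‖y‖ ^ 2 + e := by positivity
  have h1 : (‖y‖ ^ 2 + e) ^ (-(3 / 2) : ℝ) =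
      (‖y‖ ^ 2 + e) * (‖y‖ ^ 2 + e) ^ (-(5 / 2) : ℝ) := by
    conv_rhs => enter [1]; rw [← Real.rpow_one (‖y‖ ^ 2 + e)]
    rw [← Real.rpow_add hs]; norm_num
  simp only [regKer₂, h1, kd, Fin.sum_univ_three, if_true]
  have h2 : ‖y‖ ^ 2 = y 0 ^ 2 + y 1 ^ 2 + y 2 ^ 2 := by
    rw [EuclideanSpace.real_norm_sq_eq, Fin.sum_univ_three]
  generalize (‖y‖ ^ 2 + e) ^ (-(5 / 2) : ℝ) = w
  rw [h2]
  ring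

lemma rpow_neg_le_of_add {e : ℝ} (he : 0 < e) (y : E3) {p : ℝ} (hp : p ≤ 0) :
    (‖y‖ ^ 2 + e) ^ p ≤ e ^ p :=
  Real.rpow_le_rpow_of_nonpos he (by nlinarith [sq_nonneg ‖y‖]) hp

lemma continuous_rpow_reg {e : ℝ} (he : 0 < e) (p : ℝ) :
    Continuous fun y : E3 => (‖y‖ ^ 2 + e) ^ p :=
  Continuous.rpow_const (by fun_prop) fun y => Or.inl (by positivity)

lemma tame_regKer {e : ℝ} (he : 0 < e) : Tame (regKer e) := by
  refine Tame.of_bounded (continuous_rpow_reg he _) (C := e ^ (-(1 / 2) : ℝ)) fun y => ?_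
  rw [regKer, abs_of_nonneg (by positivity)]
  exact rpow_neg_le_of_add he y (p := (-(1 / 2))) (by norm_num)

lemma tame_regKer₁ {e : ℝ} (he : 0 < e) (a : Fin 3) : Tame (regKer₁ e a) := by
  have := continuous_rpow_reg he (-(3 / 2))
  refine Tame.of_bounded (by unfold regKer₁; fun_prop) (C := e⁻¹) fun y => ?_
  refine (abs_regKer₁_le he a y).trans ?_
  gcongr
  nlinarith [sq_nonneg ‖y‖]

lemma tame_regKer₂ {e : ℝ} (he : 0 < e) (a b : Fin 3) : Tame (regKer₂ e a b) := by
  have := continuous_rpow_reg he (-(3 / 2))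
  have := continuous_rpow_reg he (-(5 / 2))
  refine Tame.of_bounded (by unfold regKer₂; fun_prop) (C := 4 * e ^ (-(3 / 2) : ℝ)) fun y => ?_
  refine (abs_regKer₂_le he a b y).trans ?_
  exact mul_le_mul_of_nonneg_left (rpow_neg_le_of_add he y (p := (-(3 / 2))) (by norm_num))
    (by norm_num)

lemma tame_regKer₃ {e : ℝ} (he : 0 < e) (a b c : Fin 3) : Tame (regKer₃ e a b c) := by
  have := continuous_rpow_reg he (-(7 / 2))
  have := continuous_rpow_reg he (-(5 / 2))
  refine Tame.of_bounded (by unfold regKer₃; fun_prop) (C := 24 * e ^ (-2 : ℝ)) fun y => ?_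
  refine (abs_regKer₃_le he a b c y).trans ?_
  exact mul_le_mul_of_nonneg_left (rpow_neg_le_of_add he y (p := (-2)) (by norm_num)) (by norm_num)

lemma sq_lintegral_mul_le {k G : E3 → ℝ≥0∞} (hk : Measurable k) (hG : Measurable G) :
    (∫⁻ y, k y * G y) ^ 2 ≤ (∫⁻ y, k y) * ∫⁻ y, k y * G y ^ 2 := by
  have h := ENNReal.lintegral_mul_le_Lp_mul_Lq (volume : Measure E3) Real.HolderConjugate.two_two
    (f := fun y => k y ^ (1 / 2 : ℝ)) (g := fun y => k y ^ (1 / 2 : ℝ) * G y)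
    (by fun_prop) (by fun_prop)
  have e0 : ∀ t : ℝ≥0∞, t ^ (1 / 2 : ℝ) * t ^ (1 / 2 : ℝ) = t := fun t => by
    rw [← ENNReal.rpow_add_of_nonneg _ _ (by norm_num) (by norm_num)]
    norm_num
  have e1 : ∀ y, ((fun y => k y ^ (1 / 2 : ℝ)) * fun y => k y ^ (1 / 2 : ℝ) * G y) y
      = k y * G y := fun y => by
    simp only [Pi.mul_apply]
    rw [← mul_assoc, e0]
  have e2 : ∀ y, (k y ^ (1 / 2 : ℝ)) ^ (2 : ℝ) = k y := fun y => by
    rw [← ENNReal.rpow_mul]; norm_num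
  have e3 : ∀ y, (k y ^ (1 / 2 : ℝ) * G y) ^ (2 : ℝ) = k y * G y ^ 2 := fun y => by
    rw [ENNReal.mul_rpow_of_nonneg _ _ (by norm_num), e2, ENNReal.rpow_two]
  simp only [e1, e2, e3] at h
  calc (∫⁻ y, k y * G y) ^ 2
      ≤ ((∫⁻ y, k y) ^ (1 / 2 : ℝ) * (∫⁻ y, k y * G y ^ 2) ^ (1 / 2 : ℝ)) ^ 2 := by gcongr
    _ = _ := by rw [mul_pow, pow_two, pow_two, e0, e0]

/-- Young's inequality `L¹ * L² → L²` on a set, with translation-uniform control of the density. -/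
lemma setLIntegral_conv_sq_le (S : Set E3) {k G : E3 → ℝ≥0∞} (hk : Measurable k)
    (hG : Measurable G) {M : ℝ≥0∞} (hM : ∀ y, ∫⁻ x in S, G (x - y) ^ 2 ≤ M) :
    ∫⁻ x in S, (∫⁻ y, k y * G (x - y)) ^ 2 ≤ (∫⁻ y, k y) ^ 2 * M := by
  have hm : Measurable fun p : E3 × E3 => k p.2 * G (p.1 - p.2) ^ 2 := by fun_prop
  calc ∫⁻ x in S, (∫⁻ y, k y * G (x - y)) ^ 2
      ≤ ∫⁻ x in S, (∫⁻ y, k y) * ∫⁻ y, k y * G (x - y) ^ 2 :=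
        lintegral_mono fun x => sq_lintegral_mul_le hk (by fun_prop)
    _ = (∫⁻ y, k y) * ∫⁻ x in S, ∫⁻ y, k y * G (x - y) ^ 2 :=
        lintegral_const_mul _ hm.lintegral_prod_right'
    _ = (∫⁻ y, k y) * ∫⁻ y, ∫⁻ x in S, k y * G (x - y) ^ 2 := by
        rw [lintegral_lintegral_swap hm.aemeasurable]
    _ = (∫⁻ y, k y) * ∫⁻ y, k y * ∫⁻ x in S, G (x - y) ^ 2 := by
        congr 2 with y
        exact lintegral_const_mul _ (by fun_prop)
    _ ≤ (∫⁻ y, k y) * ∫⁻ y, k y * M := by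
        gcongr with y
        exact hM y
    _ = _ := by rw [lintegral_mul_const _ hk, pow_two, mul_assoc]

lemma enorm_conv_le (K h : E3 → ℝ) (x : E3) :
    ‖conv K h x‖ₑ ≤ ∫⁻ y, ‖K y‖ₑ * ‖h (x - y)‖ₑ := by
  refine (enorm_integral_le_lintegral_enorm _).trans (le_of_eq ?_)
  simp only [enorm_mul]

lemma conv_comm (K h : E3 → ℝ) (x : E3) : conv K h x = conv h K x := by
  unfold conv
  rw [← integral_sub_left_eq_self _ volume x]
  simp only [sub_sub_cancel, mul_comm]

lemma lintegral_conv_sq_le {K h : E3 → ℝ} (hK : Measurable K) (hh : Measurable h) :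
    ∫⁻ x, ‖conv K h x‖ₑ ^ 2 ≤ (∫⁻ y, ‖K y‖ₑ) ^ 2 * ∫⁻ x, ‖h x‖ₑ ^ 2 := by
  have := setLIntegral_conv_sq_le univ (k := fun y => ‖K y‖ₑ) (G := fun y => ‖h y‖ₑ)
    (M := ∫⁻ x, ‖h x‖ₑ ^ 2) (by fun_prop) (by fun_prop) (fun y => by
      rw [Measure.restrict_univ, lintegral_sub_right_eq_self (fun x => ‖h x‖ₑ ^ 2) y])
  rw [Measure.restrict_univ] at this
  refine le_trans ?_ this
  gcongr with x
  exact enorm_conv_le K h x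

lemma memLp_two_of_lintegral {f : E3 → ℝ} (hf : AEStronglyMeasurable f)
    (h : ∫⁻ x, ‖f x‖ₑ ^ 2 < ⊤) : MemLp f 2 := by
  refine ⟨hf, ?_⟩
  rw [eLpNorm_lt_top_iff_lintegral_rpow_enorm_lt_top two_ne_zero ENNReal.ofNat_ne_top]
  simpa using h

lemma measurable_regKer₁ {e : ℝ} (a : Fin 3) : Measurable (regKer₁ e a) := by
  unfold regKer₁; fun_prop

lemma lintegral_regKer₁_sq_lt_top {e : ℝ} (he : 0 < e) (a : Fin 3) :
    ∫⁻ y, ‖regKer₁ e a y‖ₑ ^ 2 < ⊤ := by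
  have hi : Integrable (fun y => regKer₁ e a y ^ 2) := by
    refine ((integrable_rpow_neg_one_add_norm_sq (E := E3) (μ := volume) (r := 4)
      (by simp; norm_num)).const_mul ((1 + e⁻¹) ^ 2)).mono'
      ((measurable_regKer₁ a).pow_const 2).aestronglyMeasurable (Eventually.of_forall fun y => ?_)
    have h0 := abs_regKer₁_le he a y
    have hs : 0 < ‖y‖ ^ 2 + e := by positivity
    have e1 : (1 + ‖y‖ ^ 2) ^ (-(4 : ℝ) / 2) = ((1 + ‖y‖ ^ 2)⁻¹) ^ 2 := by
      rw [show (-(4 : ℝ) / 2) = -(2 : ℕ) by norm_num, Real.rpow_neg (by positivity),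
        Real.rpow_natCast, inv_pow]
    rw [e1, norm_pow, Real.norm_eq_abs, ← mul_pow]
    gcongr
    refine h0.trans ?_
    rw [← div_eq_mul_inv, inv_eq_one_div, div_le_div_iff₀ (by positivity) (by positivity)]
    have : e⁻¹ * e = 1 := inv_mul_cancel₀ he.ne'
    have : 0 < e⁻¹ := by positivity
    nlinarith [sq_nonneg ‖y‖, mul_nonneg this.le (sq_nonneg ‖y‖)]
  have := hi.2
  simpa [HasFiniteIntegral, enorm_pow] using this

lemma memLp_conv_regKer₁ {e : ℝ} (he : 0 < e) (a : Fin 3) (h : SchwartzMap E3 ℝ) :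
    MemLp (conv (regKer₁ e a) h) 2 := by
  refine memLp_two_of_lintegral
    ((tame_regKer₁ he a).differentiable_conv h).continuous.aestronglyMeasurable ?_
  simp_rw [conv_comm (regKer₁ e a)]
  refine (lintegral_conv_sq_le h.continuous.measurable (measurable_regKer₁ a)).trans_lt ?_
  exact ENNReal.mul_lt_top (ENNReal.pow_lt_top h.integrable.2) (lintegral_regKer₁_sq_lt_top he a)

lemma kd_comm (a b : Fin 3) : kd a b = kd b a := by
  simp [kd, eq_comm]

lemma regKer₃_comm (e : ℝ) (a b : Fin 3) : regKer₃ e a b b = regKer₃ e b b a := by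
  funext y
  simp only [regKer₃, kd_comm a b]
  ring

lemma conv_regKer₁_sd {e : ℝ} (he : 0 < e) (a b : Fin 3) (h : SchwartzMap E3 ℝ) :
    conv (regKer₁ e a) (sd b h) = conv (regKer₂ e a b) h :=
  funext fun x => conv_sd (tame_regKer₁ he a) (tame_regKer₂ he a b)
    (hasLineDerivAt_regKer₁ he a b) h x

lemma conv_regKer₂_sd {e : ℝ} (he : 0 < e) (a b c : Fin 3) (h : SchwartzMap E3 ℝ) :
    conv (regKer₂ e a b) (sd c h) = conv (regKer₃ e a b c) h :=
  funext fun x => conv_sd (tame_regKer₂ he a b) (tame_regKer₃ he a b c)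
    (hasLineDerivAt_regKer₂ he a b c) h x

lemma memLp_conv_regKer₂ {e : ℝ} (he : 0 < e) (a b : Fin 3) (h : SchwartzMap E3 ℝ) :
    MemLp (conv (regKer₂ e a b) h) 2 := by
  rw [← conv_regKer₁_sd he]
  exact memLp_conv_regKer₁ he a _

/-- Two integrations by parts exchange mixed second derivatives for pure ones. -/
lemma integral_mixed_sq {e : ℝ} (he : 0 < e) (a b : Fin 3) (h : SchwartzMap E3 ℝ) :
    ∫ x, conv (regKer₂ e a b) h x * conv (regKer₂ e a b) h x =
      ∫ x, conv (regKer₂ e b b) h x * conv (regKer₂ e a a) h x := by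
  have hU : ∀ c x, fderiv ℝ (conv (regKer₁ e a) h) x (EuclideanSpace.single c 1) =
      conv (regKer₂ e a c) h x := fun c x => by
    rw [(tame_regKer₁ he a).fderiv_conv, conv_regKer₁_sd he]
  have hA : ∀ p q c x, fderiv ℝ (conv (regKer₂ e p q) h) x (EuclideanSpace.single c 1) =
      conv (regKer₃ e p q c) h x := fun p q c x => by
    rw [(tame_regKer₂ he p q).fderiv_conv, conv_regKer₂_sd he]
  have m1 := memLp_conv_regKer₁ he a h
  have m2 := fun p q => memLp_conv_regKer₂ he p q h
  have m3 : ∀ p q c, MemLp (conv (regKer₃ e p q c) h) 2 := fun p q c => by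
    rw [← conv_regKer₂_sd he]
    exact memLp_conv_regKer₂ he p q _
  have step : ∀ p q c, ∫ x, conv (regKer₂ e p q) h x * conv (regKer₂ e a c) h x =
      - ∫ x, conv (regKer₃ e p q c) h x * conv (regKer₁ e a) h x := fun p q c => by
    have := integral_mul_fderiv_eq_neg_fderiv_mul_of_integrable (μ := (volume : Measure E3))
      (f := conv (regKer₂ e p q) h) (g := conv (regKer₁ e a) h)
      (v := EuclideanSpace.single c 1)
      (by simp only [hA]; exact (m3 p q c).integrable_mul m1)
      (by simp only [hU]; exact (m2 p q).integrable_mul (m2 a c))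
      ((m2 p q).integrable_mul m1)
      (fun x _ => (tame_regKer₂ he p q).differentiable_conv h x)
      (fun x _ => (tame_regKer₁ he a).differentiable_conv h x)
    simpa only [hA, hU] using this
  rw [step a b b, step b b a, regKer₃_comm]

/-- The bump `-Δ regKer`. -/
def regBump (e : ℝ) (y : E3) : ℝ := 3 * e * (‖y‖ ^ 2 + e) ^ (-(5 / 2) : ℝ)

lemma sum_conv_regKer₂ {e : ℝ} (he : 0 < e) (h : SchwartzMap E3 ℝ) (x : E3) :
    ∑ a, conv (regKer₂ e a a) h x = - conv (regBump e) h x := by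
  have hi : ∀ a, Integrable fun y => regKer₂ e a a y * h (x - y) := fun a =>
    (tame_regKer₂ he a a).integrable_mul h x
  unfold conv
  rw [← integral_finsetSum _ fun a _ => hi a, ← integral_neg]
  congr 1 with y
  rw [← Finset.sum_mul, sum_regKer₂ he, regBump, neg_mul]

lemma integrable_regBump_one : Integrable (regBump 1) := by
  have h := integrable_rpow_neg_one_add_norm_sq (E := E3) (μ := volume) (r := 5)
    (by simp; norm_num)
  refine (h.const_mul 3).congr (Eventually.of_forall fun y => ?_)
  simp only [regBump]
  rw [add_comm, neg_div, mul_one]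

lemma regBump_sq {R : ℝ} (hR : 0 < R) (y : E3) :
    regBump (R ^ 2) y = (R ^ 3)⁻¹ * regBump 1 (R⁻¹ • y) := by
  have e1 : ‖R⁻¹ • y‖ ^ 2 + 1 = (R ^ 2)⁻¹ * (‖y‖ ^ 2 + R ^ 2) := by
    rw [norm_smul, mul_pow, Real.norm_of_nonneg (by positivity)]
    field_simp
  have e2 : ((R ^ 2)⁻¹ : ℝ) ^ (-(5 / 2) : ℝ) = R ^ 5 := by
    rw [← Real.rpow_natCast R 2, ← Real.rpow_neg hR.le, ← Real.rpow_mul hR.le,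
      ← Real.rpow_natCast R 5]
    norm_num
  simp only [regBump]
  rw [e1, Real.mul_rpow (by positivity) (by positivity), e2]
  field_simp

lemma lintegral_regBump {R : ℝ} (hR : 0 < R) :
    ∫⁻ y, ‖regBump (R ^ 2) y‖ₑ = ENNReal.ofReal (∫ y, regBump 1 y) := by
  have hnn : ∀ e, 0 < e → ∀ y, 0 ≤ regBump e y := fun e he y => by
    unfold regBump; positivity
  have hi : Integrable (regBump (R ^ 2)) := by
    have := ((integrable_regBump_one.comp_smul (inv_ne_zero hR.ne')).const_mul (R ^ 3)⁻¹)
    exact this.congr (Eventually.of_forall fun y => (regBump_sq hR y).symm)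
  have : ∫ y, regBump (R ^ 2) y = ∫ y, regBump 1 y := by
    simp_rw [regBump_sq hR]
    rw [integral_const_mul, Measure.integral_comp_inv_smul_of_nonneg volume _ hR.le]
    simp
    field_simp
  rw [← this, ofReal_integral_eq_lintegral_ofReal hi
    (Eventually.of_forall (hnn _ (by positivity)))]
  congr 1 with y
  rw [Real.enorm_eq_ofReal (hnn _ (by positivity) y)]

lemma lintegral_enorm_sq_eq {f : E3 → ℝ} (hf : MemLp f 2) :
    ∫⁻ x, ‖f x‖ₑ ^ 2 = ENNReal.ofReal (∫ x, f x * f x) := by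
  have hi : Integrable fun x => f x * f x := hf.integrable_mul hf
  rw [ofReal_integral_eq_lintegral_ofReal hi
    (Eventually.of_forall fun x => mul_self_nonneg _)]
  congr 1 with x
  rw [← enorm_pow, ← pow_two, Real.enorm_eq_ofReal (sq_nonneg _)]

/-- The `L²` bound for second derivatives of the regularised potential. -/
lemma lintegral_conv_regKer₂_sq_le {R : ℝ} (hR : 0 < R) (a b : Fin 3) (h : SchwartzMap E3 ℝ) :
    ∫⁻ x, ‖conv (regKer₂ (R ^ 2) a b) h x‖ₑ ^ 2 ≤
      ENNReal.ofReal (∫ y, regBump 1 y) ^ 2 * ∫⁻ x, ‖h x‖ₑ ^ 2 := by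
  have he : 0 < R ^ 2 := by positivity
  set e := R ^ 2
  have m2 := fun p q => memLp_conv_regKer₂ he p q h
  have hle : ∫ x, conv (regKer₂ e a b) h x * conv (regKer₂ e a b) h x ≤
      ∫ x, conv (regBump e) h x * conv (regBump e) h x := by
    calc _ ≤ ∑ p, ∑ q, ∫ x, conv (regKer₂ e p q) h x * conv (regKer₂ e p q) h x := by
          refine le_trans ?_ (Finset.single_le_sum (fun p _ => Finset.sum_nonneg fun q _ =>
            integral_nonneg fun x => mul_self_nonneg _) (Finset.mem_univ a))
          exact Finset.single_le_sum (f := fun q => ∫ x, conv (regKer₂ e a q) h x *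
            conv (regKer₂ e a q) h x) (fun q _ => integral_nonneg fun x => mul_self_nonneg _)
            (Finset.mem_univ b)
      _ = ∑ p, ∑ q, ∫ x, conv (regKer₂ e q q) h x * conv (regKer₂ e p p) h x := by
          exact Finset.sum_congr rfl fun p _ => Finset.sum_congr rfl fun q _ =>
            integral_mixed_sq he p q h
      _ = ∫ x, ∑ p, ∑ q, conv (regKer₂ e q q) h x * conv (regKer₂ e p p) h x := by
          have hi : ∀ p q, Integrable fun x =>
              conv (regKer₂ e q q) h x * conv (regKer₂ e p p) h x :=
            fun p q => (m2 q q).integrable_mul (m2 p p)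
          rw [integral_finsetSum _ fun p _ => integrable_finsetSum _ fun q _ => hi p q]
          refine Finset.sum_congr rfl fun p _ => ?_
          exact (integral_finsetSum _ fun q _ => hi p q).symm
      _ = _ := by
          congr 1 with x
          simp only [← Finset.sum_mul, ← Finset.mul_sum, sum_conv_regKer₂ he]
          ring
  have hB : MemLp (conv (regBump e) h) 2 := by
    have : conv (regBump e) h = -∑ p, conv (regKer₂ e p p) h := by
      funext x
      have := sum_conv_regKer₂ he h x
      simp only [Pi.neg_apply, Finset.sum_apply]
      linarith
    rw [this]
    exact (memLp_finsetSum' _ fun p _ => m2 p p).neg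
  rw [lintegral_enorm_sq_eq (m2 a b)]
  refine (ENNReal.ofReal_le_ofReal hle).trans ?_
  rw [← lintegral_enorm_sq_eq hB, ← lintegral_regBump hR]
  exact lintegral_conv_sq_le (by unfold regBump; fun_prop) h.continuous.measurable

/-- The Newtonian kernel. -/
def newt (y : E3) : ℝ := 1 / (4 * π * ‖y‖)

lemma tame_newt : Tame newt := by
  have hm : Measurable newt := by unfold newt; fun_prop
  refine ⟨hm.aestronglyMeasurable, ?_⟩
  have h := integrable_fun_norm_addHaar (volume : Measure E3) (F := ℝ)
    (f := fun r => 1 / (4 * π * r) * ((1 + r) ^ 4)⁻¹)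
  refine h.2 ?_
  have h3 : IntegrableOn (fun r : ℝ => (1 + r) ^ (-3 : ℝ)) (Ioi 0) := by
    have := (integrable_one_add_norm (E := ℝ) (μ := volume) (r := 3) (by simp)).integrableOn
      (s := Ioi 0)
    refine this.congr_fun (fun r hr => ?_) measurableSet_Ioi
    simp only [Real.norm_of_nonneg (mem_Ioi.1 hr).le]
  refine h3.mono' (by simp; fun_prop) ?_
  refine (ae_restrict_iff' measurableSet_Ioi).2 (Eventually.of_forall fun r hr => ?_)
  have hr : 0 < r := hr
  have e3 : (1 + r) ^ (-3 : ℝ) = ((1 + r) ^ 3)⁻¹ := by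
    rw [Real.rpow_neg (by positivity)]; norm_cast
  have : Module.finrank ℝ E3 = 3 := by simp
  rw [this, e3, Real.norm_of_nonneg (by simp; positivity)]
  simp only [smul_eq_mul, one_div, Nat.add_one_sub_one]
  have hpi := Real.pi_gt_three
  rw [← mul_inv, ← div_eq_mul_inv, inv_eq_one_div ((1 + r) ^ 3),
    div_le_div_iff₀ (by positivity) (by positivity)]
  have : r ^ (3 - 1) * (1 + r) ^ 3 ≤ r * (1 + r) ^ 4 := by
    have : r * (1 + r) ^ 4 - r ^ (3 - 1) * (1 + r) ^ 3 = r * (1 + r) ^ 3 := by ring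
    have : 0 ≤ r * (1 + r) ^ 3 := by positivity
    linarith
  refine this.trans ?_
  have : 0 ≤ r * (1 + r) ^ 4 := by positivity
  nlinarith

/-- The twice differentiated Newtonian potential as a convolution. -/
lemma fderiv_fderiv_newt (i a b : Fin 3) (Γ : SchwartzMap E3 ℝ) (x : E3) :
    fderiv ℝ (fun z =>
      fderiv ℝ (fun w =>
          ∫ y : E3, (1 / (4 * π * ‖w - y‖)) * fderiv ℝ (⇑Γ) y (EuclideanSpace.single i 1))
        z (EuclideanSpace.single a 1)) x (EuclideanSpace.single b 1) =
      conv newt (sd b (sd a (sd i Γ))) x := by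
  have h0 : (fun w => ∫ y : E3, (1 / (4 * π * ‖w - y‖)) *
      fderiv ℝ (⇑Γ) y (EuclideanSpace.single i 1)) = conv newt (sd i Γ) := by
    funext w
    rw [conv_comm]
    simp only [conv, sd_apply, newt, mul_comm]
  simp only [h0, tame_newt.fderiv_conv]

lemma tendsto_conv_regKer {e : ℕ → ℝ} (he : ∀ n, 0 < e n) (hl : Tendsto e atTop (𝓝 0))
    (h : SchwartzMap E3 ℝ) (x : E3) :
    Tendsto (fun n => (4 * π)⁻¹ * conv (regKer (e n)) h x) atTop (𝓝 (conv newt h x)) := by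
  simp only [conv, ← integral_const_mul]
  have hne : ∀ᵐ y : E3, y ≠ 0 := by
    simp [ae_iff]
  refine tendsto_integral_of_dominated_convergence (fun y => ‖newt y * h (x - y)‖)
    (fun n => (((tame_regKer (he n)).integrable_mul h x).const_mul _).1)
    (tame_newt.integrable_mul h x).norm (fun n => ?_) ?_
  · filter_upwards [hne] with y hy
    have hy' : 0 < ‖y‖ := norm_pos_iff.2 hy
    rw [← mul_assoc, norm_mul, norm_mul (newt y)]
    gcongr
    have := he n
    rw [regKer, newt, Real.norm_of_nonneg (by positivity), Real.norm_of_nonneg (by positivity),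
      one_div (_ * _), mul_inv (4 * π)]
    refine mul_le_mul_of_nonneg_left ?_ (by positivity)
    calc (‖y‖ ^ 2 + e n) ^ (-(1 / 2) : ℝ) ≤ (‖y‖ ^ 2) ^ (-(1 / 2) : ℝ) :=
          Real.rpow_le_rpow_of_nonpos (by positivity) (by linarith) (by norm_num)
      _ = ‖y‖⁻¹ := by
          rw [← Real.rpow_natCast, ← Real.rpow_mul hy'.le, ← Real.rpow_neg_one]
          norm_num
  · filter_upwards [hne] with y hy
    have hy' : 0 < ‖y‖ := norm_pos_iff.2 hy
    have h1 : Tendsto (fun n => regKer (e n) y) atTop (𝓝 ((‖y‖ ^ 2 + 0) ^ (-(1 / 2) : ℝ))) :=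
      (tendsto_const_nhds.add hl).rpow_const (Or.inl (by positivity))
    have h2 : (‖y‖ ^ 2 + 0) ^ (-(1 / 2) : ℝ) = ‖y‖⁻¹ := by
      rw [add_zero, ← Real.rpow_natCast, ← Real.rpow_mul hy'.le, ← Real.rpow_neg_one]
      norm_num
    rw [h2] at h1
    have h3 : newt y * h (x - y) = (4 * π)⁻¹ * (‖y‖⁻¹ * h (x - y)) := by
      rw [newt, one_div, mul_inv, mul_assoc]
    rw [h3]
    exact (h1.mul_const (h (x - y))).const_mul (4 * π)⁻¹

/-- The slab of half-width one around height `z`. -/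
def slab (z : ℝ) : Set E3 := {x : E3 | x 2 ∈ Set.Icc (z - 1) (z + 1)}

lemma measurableSet_slab (z : ℝ) : MeasurableSet (slab z) := by
  have : Measurable fun x : E3 => x 2 := by fun_prop
  exact this measurableSet_Icc

lemma eLpNorm_two_sq (g : E3 → ℝ) (μ : Measure E3) :
    eLpNorm g 2 μ ^ 2 = ∫⁻ x, ‖g x‖ₑ ^ 2 ∂μ := by
  have := eLpNorm_nnreal_pow_eq_lintegral (μ := μ) (f := g) (p := 2) two_ne_zero
  simpa using this

lemma setLIntegral_slab_le (g : E3 → ℝ) (z : ℝ) :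
    ∫⁻ x in slab z, ‖g x‖ₑ ^ 2 ≤ uloc3 g 2 ^ 2 := by
  rw [← eLpNorm_two_sq]
  gcongr
  have := le_iSup (fun z : ℝ => eLpNorm g 2
    (volume.restrict (univ ∩ {x : E3 | x 2 ∈ Set.Icc (z - 1) (z + 1)}))) z
  rwa [univ_inter] at this

lemma uloc3_le {g : E3 → ℝ} {M : ℝ≥0∞} (h : ∀ z, ∫⁻ x in slab z, ‖g x‖ₑ ^ 2 ≤ M ^ 2) :
    uloc3 g 2 ≤ M := by
  refine iSup_le fun z => ?_
  have := h z
  rw [← eLpNorm_two_sq] at this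
  rw [univ_inter]
  exact (ENNReal.pow_le_pow_left_iff two_ne_zero).1 this

lemma setLIntegral_slab_sub_le (g : E3 → ℝ) (z : ℝ) (y : E3) :
    ∫⁻ x in slab z, ‖g (x - y)‖ₑ ^ 2 ≤ uloc3 g 2 ^ 2 := by
  refine le_trans (le_of_eq ?_) (setLIntegral_slab_le g (z - y 2))
  rw [← lintegral_indicator (measurableSet_slab _), ← lintegral_indicator (measurableSet_slab _),
    ← lintegral_sub_right_eq_self ((slab (z - y 2)).indicator _) y]
  congr 1 with x
  have : x ∈ slab z ↔ x - y ∈ slab (z - y 2) := by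
    simp only [slab, mem_ofPred_eq, mem_Icc, PiLp.sub_apply]
    constructor <;> rintro ⟨h1, h2⟩ <;> constructor <;> linarith
  by_cases hx : x ∈ slab z
  · rw [indicator_of_mem hx, indicator_of_mem (this.1 hx)]
  · rw [indicator_of_notMem hx, indicator_of_notMem (fun h => hx (this.2 h))]

lemma lintegral_sq_le_of_support {g u : E3 → ℝ} {z : ℝ} (hle : ∀ x, ‖u x‖ ≤ ‖g x‖)
    (h0 : ∀ x, 3 < |x 2 - z| → u x = 0) :
    ∫⁻ x, ‖u x‖ₑ ^ 2 ≤ 3 * uloc3 g 2 ^ 2 := by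
  have hs : ∫⁻ x, ‖u x‖ₑ ^ 2 ≤ ∫⁻ x in slab (z - 2) ∪ slab z ∪ slab (z + 2), ‖g x‖ₑ ^ 2 := by
    rw [← lintegral_indicator (((measurableSet_slab _).union (measurableSet_slab _)).union
      (measurableSet_slab _))]
    refine lintegral_mono fun x => ?_
    by_cases hx : x ∈ slab (z - 2) ∪ slab z ∪ slab (z + 2)
    · rw [indicator_of_mem hx]
      gcongr
      exact enorm_le_iff_norm_le.2 (hle x)
    · have : u x = 0 := h0 x <| by
        by_contra! hc
        refine hx ?_
        obtain ⟨h1, h2⟩ := abs_le.1 hc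
        simp only [slab, mem_union, mem_ofPred_eq, mem_Icc]
        grind
      simp [this]
  refine hs.trans ((lintegral_union_le _ _ _).trans ?_)
  refine (add_le_add_left (lintegral_union_le _ _ _) _).trans ?_
  have := setLIntegral_slab_le g
  calc _ ≤ uloc3 g 2 ^ 2 + uloc3 g 2 ^ 2 + uloc3 g 2 ^ 2 := by gcongr <;> exact this _
    _ = _ := by ring

/-- Splitting a Schwartz function by a smooth cutoff in the vertical variable. -/
lemma exists_vertical_splitting {i : Fin 3} (hi : i ≠ 2) (z : ℝ) (Γ : SchwartzMap E3 ℝ) :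
    ∃ Γ₁ Γ₂ : SchwartzMap E3 ℝ, Γ = Γ₁ + Γ₂ ∧ (∀ x, ‖Γ₂ x‖ ≤ ‖Γ x‖) ∧
      (∀ x, |x 2 - z| ≤ 2 → Γ₂ x = 0) ∧ (∀ x, ‖sd i Γ₁ x‖ ≤ ‖sd i Γ x‖) ∧
      ∀ x, 3 < |x 2 - z| → sd i Γ₁ x = 0 := by
  let χ : ContDiffBump z := ⟨2, 3, by norm_num, by norm_num⟩
  have hχ : Function.HasTemperateGrowth fun x : E3 => χ (x 2) := by
    have h1 : Function.HasTemperateGrowth (χ : ℝ → ℝ) :=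
      χ.hasCompactSupport.hasTemperateGrowth χ.contDiff
    have h2 := (EuclideanSpace.proj (𝕜 := ℝ) (2 : Fin 3)).hasTemperateGrowth
    exact h1.comp h2
  set Γ₁ := SchwartzMap.smulLeftCLM ℝ (fun x : E3 => χ (x 2)) Γ with hΓ₁
  have e1 : ∀ x, Γ₁ x = χ (x 2) * Γ x := fun x => by
    rw [hΓ₁, SchwartzMap.smulLeftCLM_apply_apply hχ]; rfl
  have e2 : ∀ x, (Γ - Γ₁) x = (1 - χ (x 2)) * Γ x := fun x => by
    rw [sub_apply, e1]; ring
  have e3 : ∀ x, sd i Γ₁ x = χ (x 2) * sd i Γ x := fun x => by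
    rw [sd_apply, sd_apply, ← Γ₁.differentiableAt.lineDeriv_eq_fderiv,
      ← Γ.differentiableAt.lineDeriv_eq_fderiv]
    unfold lineDeriv
    rw [← deriv_const_mul_field]
    congr 1 with t
    simp [e1, hi.symm]
  refine ⟨Γ₁, Γ - Γ₁, by abel, fun x => ?_, fun x hx => ?_, fun x => ?_, fun x hx => ?_⟩
  · rw [e2, norm_mul]
    refine mul_le_of_le_one_left (norm_nonneg _) ?_
    rw [Real.norm_of_nonneg (by linarith [χ.le_one (x := x 2)])]
    linarith [χ.nonneg (x := x 2)]
  · rw [e2, χ.one_of_mem_closedBall (by rwa [mem_closedBall, Real.dist_eq])]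
    simp
  · rw [e3, norm_mul]
    refine mul_le_of_le_one_left (norm_nonneg _) ?_
    rw [Real.norm_of_nonneg χ.nonneg]
    exact χ.le_one
  · rw [e3, χ.zero_of_le_dist (by rw [Real.dist_eq]; exact hx.le), zero_mul]

/-- An integrable majorant of the third derivatives of the kernel away from the origin. -/
def farKer (y : E3) : ℝ := 96 * (1 + ‖y‖ ^ 2) ^ (-(4 : ℝ) / 2)

lemma integrable_farKer : Integrable farKer :=
  (integrable_rpow_neg_one_add_norm_sq (E := E3) (μ := volume) (r := 4)
    (by simp; norm_num)).const_mul 96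

lemma abs_regKer₃_le_farKer {e : ℝ} (he : 0 < e) (a b c : Fin 3) {y : E3} (hy : 1 ≤ ‖y‖) :
    |regKer₃ e a b c y| ≤ farKer y := by
  refine (abs_regKer₃_le he a b c y).trans ?_
  have h1 : ∀ s : ℝ, 0 < s → s ^ (-2 : ℝ) = (s ^ 2)⁻¹ := fun s hs => by
    rw [Real.rpow_neg hs.le]; norm_cast
  rw [farKer, show (-(4 : ℝ) / 2) = -2 by norm_num, h1 _ (by positivity), h1 _ (by positivity),
    ← div_eq_mul_inv, ← div_eq_mul_inv, div_le_div_iff₀ (by positivity) (by positivity)]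
  have : (1 + ‖y‖ ^ 2) ^ 2 ≤ (2 * (‖y‖ ^ 2 + e)) ^ 2 := by
    gcongr
    nlinarith
  linarith

lemma setLIntegral_conv_regKer₃_far_le {e : ℝ} (he : 0 < e) (a b c : Fin 3) {z : ℝ}
    {Γ Γ₂ : SchwartzMap E3 ℝ} (hle : ∀ x, ‖Γ₂ x‖ ≤ ‖Γ x‖)
    (h0 : ∀ x, |x 2 - z| ≤ 2 → Γ₂ x = 0) :
    ∫⁻ x in slab z, ‖conv (regKer₃ e a b c) Γ₂ x‖ₑ ^ 2 ≤
      (∫⁻ y, ‖farKer y‖ₑ) ^ 2 * uloc3 Γ 2 ^ 2 := by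
  refine le_trans ?_ (setLIntegral_conv_sq_le (slab z) (k := fun y => ‖farKer y‖ₑ)
    (G := fun y => ‖Γ y‖ₑ) (by unfold farKer; fun_prop) (by fun_prop)
    (setLIntegral_slab_sub_le Γ z))
  refine setLIntegral_mono' (measurableSet_slab z) fun x hx => ?_
  gcongr
  refine (enorm_conv_le _ _ _).trans (lintegral_mono fun y => ?_)
  by_cases hy : 1 ≤ ‖y‖
  · gcongr
    · refine enorm_le_iff_norm_le.2 ((abs_regKer₃_le_farKer he a b c hy).trans (le_abs_self _))
    · exact enorm_le_iff_norm_le.2 (hle _)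
  · have : Γ₂ (x - y) = 0 := h0 _ <| by
      have h1 : |y 2| ≤ ‖y‖ := by simpa using PiLp.norm_apply_le y 2
      obtain ⟨h2, h3⟩ := hx
      obtain ⟨h4, h5⟩ := abs_le.1 (h1.trans (not_le.1 hy).le)
      rw [PiLp.sub_apply, abs_le]
      constructor <;> linarith
    simp [this]

lemma conv_add {K : E3 → ℝ} (hK : Tame K) (h₁ h₂ : SchwartzMap E3 ℝ) (x : E3) :
    conv K (h₁ + h₂ : SchwartzMap E3 ℝ) x = conv K h₁ x + conv K h₂ x := by
  have hi : ∀ h : SchwartzMap E3 ℝ, Integrable fun y => K y * h (x - y) :=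
    fun h => hK.integrable_mul h x
  unfold conv
  rw [← integral_add (hi h₁) (hi h₂)]
  simp [mul_add]

lemma setLIntegral_conv_regKer₃_le {R : ℝ} (hR : 0 < R) {i : Fin 3} (hi : i ≠ 2) (a b : Fin 3)
    (Γ : SchwartzMap E3 ℝ) (z : ℝ) :
    ∫⁻ x in slab z, ‖conv (regKer₃ (R ^ 2) a b i) Γ x‖ₑ ^ 2 ≤
      2 * (ENNReal.ofReal (∫ y, regBump 1 y) ^ 2 * (3 * uloc3 (sd i Γ) 2 ^ 2)) +
        2 * ((∫⁻ y, ‖farKer y‖ₑ) ^ 2 * uloc3 Γ 2 ^ 2) := by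
  have he : 0 < R ^ 2 := by positivity
  obtain ⟨Γ₁, Γ₂, hΓ, h1, h2, h3, h4⟩ := exists_vertical_splitting hi z Γ
  have hb1 : ∫⁻ x in slab z, ‖conv (regKer₃ (R ^ 2) a b i) Γ₁ x‖ₑ ^ 2 ≤
      ENNReal.ofReal (∫ y, regBump 1 y) ^ 2 * (3 * uloc3 (sd i Γ) 2 ^ 2) := by
    refine (setLIntegral_le_lintegral _ _).trans ?_
    rw [← conv_regKer₂_sd he]
    refine (lintegral_conv_regKer₂_sq_le hR a b _).trans ?_
    gcongr
    exact lintegral_sq_le_of_support h3 h4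
  have hb2 := setLIntegral_conv_regKer₃_far_le he a b i h1 h2
  have hmeas : Measurable fun x => ‖conv (regKer₃ (R ^ 2) a b i) Γ₁ x‖ₑ ^ 2 :=
    (((tame_regKer₃ he a b i).differentiable_conv Γ₁).continuous.measurable.enorm).pow_const 2
  calc ∫⁻ x in slab z, ‖conv (regKer₃ (R ^ 2) a b i) Γ x‖ₑ ^ 2
      ≤ ∫⁻ x in slab z, (2 * ‖conv (regKer₃ (R ^ 2) a b i) Γ₁ x‖ₑ ^ 2 +
          2 * ‖conv (regKer₃ (R ^ 2) a b i) Γ₂ x‖ₑ ^ 2) := by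
        refine lintegral_mono fun x => ?_
        simp only
        conv_lhs => rw [hΓ, conv_add (tame_regKer₃ he a b i)]
        rw [← mul_add]
        refine (pow_le_pow_left₀ zero_le (enorm_add_le _ _) 2).trans ?_
        have := ENNReal.rpow_add_le_mul_rpow_add_rpow ‖conv (regKer₃ (R ^ 2) a b i) Γ₁ x‖ₑ
          ‖conv (regKer₃ (R ^ 2) a b i) Γ₂ x‖ₑ (p := 2) (by norm_num)
        norm_num at this
        simpa using this
    _ ≤ _ := by
        rw [lintegral_add_left (hmeas.const_mul 2), lintegral_const_mul _ hmeas,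
          lintegral_const_mul' _ _ (by norm_num)]
        gcongr

lemma setLIntegral_conv_newt_le {i : Fin 3} (hi : i ≠ 2) (a b : Fin 3)
    (Γ : SchwartzMap E3 ℝ) (z : ℝ) :
    ∫⁻ x in slab z, ‖conv newt (sd b (sd a (sd i Γ))) x‖ₑ ^ 2 ≤
      2 * (ENNReal.ofReal (∫ y, regBump 1 y) ^ 2 * (3 * uloc3 (sd i Γ) 2 ^ 2)) +
        2 * ((∫⁻ y, ‖farKer y‖ₑ) ^ 2 * uloc3 Γ 2 ^ 2) := by
  have hR : ∀ n : ℕ, 0 < 1 / ((n : ℝ) + 1) := fun n => by positivity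
  have he : ∀ n : ℕ, 0 < (1 / ((n : ℝ) + 1)) ^ 2 := fun n => pow_pos (hR n) 2
  have hl : Tendsto (fun n : ℕ => (1 / ((n : ℝ) + 1)) ^ 2) atTop (𝓝 0) := by
    simpa using (tendsto_one_div_add_atTop_nhds_zero_nat (𝕜 := ℝ)).pow 2
  have hsd : ∀ n : ℕ, conv (regKer ((1 / ((n : ℝ) + 1)) ^ 2)) (sd b (sd a (sd i Γ))) =
      conv (regKer₃ ((1 / ((n : ℝ) + 1)) ^ 2) b a i) Γ := fun n => by
    rw [← conv_regKer₂_sd (he n), ← conv_regKer₁_sd (he n)]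
    exact funext fun x => conv_sd (tame_regKer (he n)) (tame_regKer₁ (he n) b)
      (hasLineDerivAt_regKer (he n) b) _ x
  have hlim := fun x => tendsto_conv_regKer he hl (sd b (sd a (sd i Γ))) x
  simp only [hsd] at hlim
  have hpi : ‖(4 * π)⁻¹‖ₑ ≤ 1 := by
    rw [← enorm_one (G := ℝ), enorm_le_iff_norm_le, Real.norm_of_nonneg (by positivity), norm_one]
    exact inv_le_one_of_one_le₀ (by linarith [Real.pi_gt_three])
  calc ∫⁻ x in slab z, ‖conv newt (sd b (sd a (sd i Γ))) x‖ₑ ^ 2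
      = ∫⁻ x in slab z, liminf (fun n : ℕ =>
          ‖(4 * π)⁻¹ * conv (regKer₃ ((1 / ((n : ℝ) + 1)) ^ 2) b a i) Γ x‖ₑ ^ 2) atTop := by
        congr 1 with x
        exact ((ENNReal.continuous_pow 2).tendsto _ |>.comp (hlim x).enorm).liminf_eq.symm
    _ ≤ liminf (fun n : ℕ => ∫⁻ x in slab z,
          ‖(4 * π)⁻¹ * conv (regKer₃ ((1 / ((n : ℝ) + 1)) ^ 2) b a i) Γ x‖ₑ ^ 2) atTop :=
        lintegral_liminf_le fun n => by
          have := ((tame_regKer₃ (he n) b a i).differentiable_conv Γ).continuous.measurable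
          fun_prop
    _ ≤ _ := by
        refine liminf_le_of_le (by isBoundedDefault) fun m hm => ?_
        obtain ⟨n, hn⟩ := hm.exists
        refine hn.trans (le_trans ?_ (setLIntegral_conv_regKer₃_le (hR n) hi b a Γ z))
        gcongr with x
        rw [enorm_mul]
        exact mul_le_of_le_one_left' hpi

/-- `L²`-3-uloc estimate for second derivatives of the Newtonian potential of `∂ᵢΓ`. -/
theorem stmt13 (i a b : Fin 3) (hi : i = 0 ∨ i = 1) :
    ∃ C : ℝ, 0 < C ∧
      ∀ Γ : SchwartzMap E3 ℝ,
        uloc3 (fun x =>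
          fderiv ℝ (fun z =>
            fderiv ℝ (fun w =>
                ∫ y : E3, (1 / (4 * π * ‖w - y‖)) * fderiv ℝ (⇑Γ) y (EuclideanSpace.single i 1))
              z (EuclideanSpace.single a 1)) x (EuclideanSpace.single b 1)) 2 ≤
        ENNReal.ofReal C *
          (uloc3 (⇑Γ) 2 +
            uloc3 (fun y => fderiv ℝ (⇑Γ) y (EuclideanSpace.single i 1)) 2) := by
  have hi2 : i ≠ 2 := by rcases hi with rfl | rfl <;> decide
  set A : ℝ := ∫ y, regBump 1 y
  have hA : 0 ≤ A := integral_nonneg fun y => by unfold regBump; positivity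
  set B : ℝ := (∫⁻ y, ‖farKer y‖ₑ).toReal
  have hB : ∫⁻ y, ‖farKer y‖ₑ = ENNReal.ofReal B :=
    (ENNReal.ofReal_toReal integrable_farKer.2.ne).symm
  have hB0 : 0 ≤ B := ENNReal.toReal_nonneg
  refine ⟨3 * A + 3 * B + 1, by positivity, fun Γ => uloc3_le fun z => ?_⟩
  simp only [fderiv_fderiv_newt]
  refine (setLIntegral_conv_newt_le hi2 a b Γ z).trans ?_
  rw [hB]
  change _ ≤ (_ * (_ + uloc3 (sd i Γ) 2)) ^ 2
  set G := uloc3 (⇑Γ) 2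
  set D := uloc3 (⇑(sd i Γ)) 2
  set C := ENNReal.ofReal (3 * A + 3 * B + 1)
  have hCA : 3 * ENNReal.ofReal A ≤ C := by
    rw [← ENNReal.ofReal_ofNat 3, ← ENNReal.ofReal_mul (by norm_num)]
    exact ENNReal.ofReal_le_ofReal (by linarith)
  have hCB : 3 * ENNReal.ofReal B ≤ C := by
    rw [← ENNReal.ofReal_ofNat 3, ← ENNReal.ofReal_mul (by norm_num)]
    exact ENNReal.ofReal_le_ofReal (by linarith)
  calc 2 * (ENNReal.ofReal A ^ 2 * (3 * D ^ 2)) + 2 * (ENNReal.ofReal B ^ 2 * G ^ 2)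
      = 6 * (ENNReal.ofReal A ^ 2 * D ^ 2) + 2 * (ENNReal.ofReal B ^ 2 * G ^ 2) := by ring
    _ ≤ 9 * (ENNReal.ofReal A ^ 2 * D ^ 2) + 9 * (ENNReal.ofReal B ^ 2 * G ^ 2) := by
        gcongr <;> norm_num
    _ = (3 * ENNReal.ofReal A) ^ 2 * D ^ 2 + (3 * ENNReal.ofReal B) ^ 2 * G ^ 2 := by ring
    _ ≤ C ^ 2 * D ^ 2 + C ^ 2 * G ^ 2 := by gcongr
    _ ≤ C ^ 2 * D ^ 2 + C ^ 2 * G ^ 2 + 2 * C ^ 2 * G * D := le_self_add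
    _ = (C * (G + D)) ^ 2 := by ring
end
end

section
/- Fix i ∈ {1,2} and a, b, c, d ∈ {1,2,3}. There exists an absolute constant C > 0 such that for every Schwartz function Γ : ℝ³ → ℝ, the function f(x) := ∫_{ℝ³} e^{2πi x·ξ} (2πi ξ_i)·(ξ_a ξ_b ξ_c ξ_d / |ξ|⁴)·Γ̂(ξ) dξ (so that f = ∂_a∂_b∂_c∂_d Δ^{−2} ∂_i Γ, realized as a Fourier multiplier) satisfies ‖f‖_{L²_{3-uloc}} ≤ C·( ‖Γ‖_{L²_{3-uloc}} + ‖∇Γ‖_{L²_{3-uloc}} ). -/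
noncomputable section
open Real MeasureTheory Filter Metric Set
open scoped ENNReal NNReal Topology FourierTransform

/-- **Plancherel's theorem** for the Fourier integral of a function in `L¹ ∩ L²`. -/
theorem eLpNorm_fourier_eq_of_integrable {V : Type*} [NormedAddCommGroup V]
    [InnerProductSpace ℝ V] [FiniteDimensional ℝ V] [MeasurableSpace V] [BorelSpace V]
    {h : V → ℂ} (h₁ : Integrable h) (h₂ : MemLp h 2) :
    eLpNorm (𝓕 h) 2 volume = eLpNorm h 2 volume := by
  have hcont : Continuous (𝓕 h) :=
    VectorFourier.fourierIntegral_continuous Real.continuous_fourierChar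
      (by exact continuous_inner) h₁
  set H : Lp ℂ 2 (volume : Measure V) := h₂.toLp h
  have key : ∀ᵐ x, (𝓕 H : Lp ℂ 2 (volume : Measure V)) x = 𝓕 h x := by
    refine ae_eq_of_integral_contDiff_smul_eq
      ((Lp.memLp _).locallyIntegrable (by norm_num)) hcont.locallyIntegrable fun g hg hgs => ?_
    let ψ : SchwartzMap V ℂ := (hgs.comp_left (g := Complex.ofRealCLM) rfl).toSchwartzMap
      (Complex.ofRealCLM.contDiff.comp hg)
    have hψ : ∀ x, ψ x = (g x : ℂ) := fun x => rfl
    have e1 := congrArg (fun T => T ψ) (Lp.fourier_toTemperedDistribution_eq H)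
    simp only [Lp.toTemperedDistribution_apply] at e1
    have e2 : ∫ x, ψ x • (𝓕 H : Lp ℂ 2 (volume : Measure V)) x = ∫ x, (𝓕 ψ) x • H x :=
      e1.symm.trans (by simp)
    have e3 : ∫ x, (𝓕 ψ) x • H x = ∫ x, (𝓕 ψ) x • h x := by
      refine integral_congr_ae ?_
      filter_upwards [h₂.coeFn_toLp] with x hx
      rw [hx]
    have e4 : ∫ x, (𝓕 (ψ : V → ℂ)) x • h x = ∫ x, ψ x • 𝓕 h x := by
      simpa using! VectorFourier.integral_fourierIntegral_smul_eq_flip (L := innerₗ V)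
        Real.continuous_fourierChar continuous_inner ψ.integrable h₁
    have e5 := e2.trans (e3.trans e4)
    simpa [hψ] using e5
  rw [← eLpNorm_congr_ae key, ← eLpNorm_congr_ae h₂.coeFn_toLp]
  have := Lp.norm_fourier_eq H
  rw [Lp.norm_def, Lp.norm_def,
    ENNReal.toReal_eq_toReal_iff' (Lp.eLpNorm_ne_top _) (Lp.eLpNorm_ne_top _)] at this
  exact this

/-- **Plancherel's theorem** for the inverse Fourier integral of a function in `L¹ ∩ L²`. -/
theorem eLpNorm_fourierInv_eq_of_integrable {V : Type*} [NormedAddCommGroup V]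
    [InnerProductSpace ℝ V] [FiniteDimensional ℝ V] [MeasurableSpace V] [BorelSpace V]
    {h : V → ℂ} (h₁ : Integrable h) (h₂ : MemLp h 2) :
    eLpNorm (𝓕⁻ h) 2 volume = eLpNorm h 2 volume := by
  have hcont : Continuous (𝓕 h) :=
    VectorFourier.fourierIntegral_continuous Real.continuous_fourierChar
      (by exact continuous_inner) h₁
  rw [← eLpNorm_fourier_eq_of_integrable h₁ h₂]
  have : 𝓕⁻ h = 𝓕 h ∘ Neg.neg := funext fun x => fourierInv_eq_fourier_neg h x
  rw [this]
  exact eLpNorm_comp_measurePreserving hcont.aestronglyMeasurable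
    (Measure.measurePreserving_neg volume)

/-- The real symbol `ξᵢ ξₐ ξ_b ξ_c ξ_d / |ξ|⁴` of `∂ₐ∂_b∂_c∂_d Δ⁻² ∂ᵢ`, up to the factor `2πi`. -/
def biLapSymbol (i a b c d : Fin 3) (ξ : E3) : ℝ :=
  ξ i * (ξ a * ξ b * ξ c * ξ d / ‖ξ‖ ^ 4)

/-- The vertical derivative of `biLapSymbol i a b c d` for a horizontal index `i`. -/
def biLapSymbolDeriv (i a b c d : Fin 3) (ξ : E3) : ℝ :=
  let e : E3 := EuclideanSpace.single 2 1
  ξ i * (((e a * ξ b + ξ a * e b) * ξ c * ξ d + ξ a * ξ b * (e c * ξ d + ξ c * e d)) / ‖ξ‖ ^ 4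
    - 4 * ξ 2 * (ξ a * ξ b * ξ c * ξ d) / ‖ξ‖ ^ 6)

theorem measurable_biLapSymbol (i a b c d : Fin 3) : Measurable (biLapSymbol i a b c d) := by
  unfold biLapSymbol; fun_prop

theorem measurable_biLapSymbolDeriv (i a b c d : Fin 3) :
    Measurable (biLapSymbolDeriv i a b c d) := by
  unfold biLapSymbolDeriv; fun_prop

theorem abs_coord_le_norm (ξ : E3) (k : Fin 3) : |ξ k| ≤ ‖ξ‖ := by
  simpa using PiLp.norm_apply_le ξ k

theorem abs_mul_four_le {x y z w r s t u : ℝ} (hx : |x| ≤ r) (hy : |y| ≤ s) (hz : |z| ≤ t)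
    (hw : |w| ≤ u) : |x * y * z * w| ≤ r * s * t * u := by
  have hr := (abs_nonneg x).trans hx
  have hs := (abs_nonneg y).trans hy
  have ht := (abs_nonneg z).trans hz
  simp only [abs_mul]
  gcongr

theorem abs_biLapSymbol_le (i a b c d : Fin 3) (ξ : E3) : |biLapSymbol i a b c d ξ| ≤ |ξ i| := by
  unfold biLapSymbol
  rw [abs_mul, abs_div, abs_of_nonneg (by positivity : (0 : ℝ) ≤ ‖ξ‖ ^ 4)]
  refine mul_le_of_le_one_right (abs_nonneg _) (div_le_one_of_le₀ ?_ (by positivity))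
  have h := abs_coord_le_norm ξ
  exact (abs_mul_four_le (h a) (h b) (h c) (h d)).trans_eq (by ring)

theorem abs_biLapSymbolDeriv_le (i a b c d : Fin 3) (ξ : E3) :
    |biLapSymbolDeriv i a b c d ξ| ≤ 8 := by
  rcases eq_or_ne ξ 0 with rfl | hξ
  · simp [biLapSymbolDeriv]
  have hr : 0 < ‖ξ‖ := norm_pos_iff.2 hξ
  have h := abs_coord_le_norm ξ
  have he : ∀ k, |(EuclideanSpace.single 2 1 : E3) k| ≤ 1 := fun k => by
    simpa using abs_coord_le_norm (EuclideanSpace.single 2 1) k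
  unfold biLapSymbolDeriv
  simp only
  set e : E3 := EuclideanSpace.single 2 1
  set r := ‖ξ‖
  have h1 := abs_mul_four_le (he a) (h b) (h c) (h d)
  have h2 := abs_mul_four_le (h a) (he b) (h c) (h d)
  have h3 := abs_mul_four_le (h a) (h b) (he c) (h d)
  have h4 := abs_mul_four_le (h a) (h b) (h c) (he d)
  have h5 := abs_mul_four_le (h a) (h b) (h c) (h d)
  have hA : |(e a * ξ b + ξ a * e b) * ξ c * ξ d + ξ a * ξ b * (e c * ξ d + ξ c * e d)|
      ≤ 4 * r ^ 3 := by
    rw [abs_le] at *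
    constructor <;> nlinarith
  have hB : |4 * ξ 2 * (ξ a * ξ b * ξ c * ξ d)| ≤ 4 * r * r ^ 4 := by
    rw [abs_mul, abs_mul, abs_of_pos (by norm_num : (0 : ℝ) < 4)]
    have := h 2
    have h5' : |ξ a * ξ b * ξ c * ξ d| ≤ r ^ 4 := h5.trans_eq (by ring)
    gcongr
  have hA' : |((e a * ξ b + ξ a * e b) * ξ c * ξ d + ξ a * ξ b * (e c * ξ d + ξ c * e d)) / r ^ 4|
      ≤ 4 / r := by
    rw [abs_div, abs_of_pos (by positivity : 0 < r ^ 4), div_le_div_iff₀ (by positivity) hr]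
    nlinarith
  have hB' : |4 * ξ 2 * (ξ a * ξ b * ξ c * ξ d) / r ^ 6| ≤ 4 / r := by
    rw [abs_div, abs_of_pos (by positivity : 0 < r ^ 6), div_le_div_iff₀ (by positivity) hr]
    nlinarith
  rw [abs_mul]
  calc _ ≤ r * (4 / r + 4 / r) := by
        gcongr
        · exact h i
        · exact (abs_sub _ _).trans (add_le_add hA' hB')
    _ = 8 := by field_simp; norm_num

theorem hasLineDerivAt_biLapSymbol {i : Fin 3} (a b c d : Fin 3) (hi : i ≠ 2) (ξ : E3) :
    HasLineDerivAt ℝ (biLapSymbol i a b c d) (biLapSymbolDeriv i a b c d ξ) ξ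
      (EuclideanSpace.single 2 1) := by
  unfold HasLineDerivAt
  set e : E3 := EuclideanSpace.single 2 1 with he
  have hei : e i = 0 := by simp [he, hi]
  have hk : ∀ k, HasDerivAt (fun t : ℝ => (ξ + t • e) k) (e k) 0 := fun k => by
    simpa using ((hasDerivAt_id (0 : ℝ)).mul_const (e k)).const_add (ξ k)
  have hconst : ∀ t : ℝ, (ξ + t • e) i = ξ i := fun t => by simp [hei]
  by_cases h0 : ξ i = 0
  · have h1 : (fun t : ℝ => biLapSymbol i a b c d (ξ + t • e)) = fun _ => 0 := by
      funext t
      unfold biLapSymbol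
      rw [hconst, h0, zero_mul]
    have h2 : biLapSymbolDeriv i a b c d ξ = 0 := by simp [biLapSymbolDeriv, h0]
    rw [h1, h2]
    exact hasDerivAt_const _ _
  have hξ : ξ ≠ 0 := by
    rintro rfl
    exact h0 rfl
  have hr : ‖ξ‖ ≠ 0 := norm_ne_zero_iff.2 hξ
  have hsq : HasDerivAt (fun t : ℝ => ‖ξ + t • e‖ ^ 2) (2 * ξ 2) 0 := by
    have h3 := (((hk 0).pow 2).add ((hk 1).pow 2)).add ((hk 2).pow 2)
    have : (fun t : ℝ => ‖ξ + t • e‖ ^ 2)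
        = fun t => (ξ + t • e) 0 ^ 2 + (ξ + t • e) 1 ^ 2 + (ξ + t • e) 2 ^ 2 := by
      funext t
      rw [EuclideanSpace.real_norm_sq_eq, Fin.sum_univ_three]
    rw [this]
    refine h3.congr_deriv ?_
    simp [he]
  have hq : HasDerivAt (fun t : ℝ => ‖ξ + t • e‖ ^ 4) (4 * ξ 2 * ‖ξ‖ ^ 2) 0 := by
    have : (fun t : ℝ => ‖ξ + t • e‖ ^ 4) = fun t => (‖ξ + t • e‖ ^ 2) ^ 2 := by
      funext t; ring
    rw [this]
    refine (hsq.pow 2).congr_deriv ?_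
    simp
    ring
  have hP := (((hk a).mul (hk b)).mul (hk c)).mul (hk d)
  have hM := (hk i).mul (hP.div hq (by simpa using hr))
  refine hM.congr_deriv ?_
  simp only [hei, biLapSymbolDeriv, ← he, Pi.mul_apply, zero_smul, add_zero]
  field_simp
  ring

open LineDeriv in
theorem fourier_eq_lineDeriv_add_of_eq_coord_mul {z : ℝ} {g G : SchwartzMap E3 ℂ}
    (hG : ∀ x, G x = ((x 2 - z : ℝ) + Complex.I) * g x) (ξ : E3) :
    2 * π * Complex.I * 𝓕 G ξ =
      -(∂_{(EuclideanSpace.single 2 1 : E3)} (𝓕 g)) ξ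
        + 2 * π * Complex.I * (Complex.I - z) * 𝓕 g ξ := by
  have ht : (fun x : E3 => inner ℝ x (EuclideanSpace.single 2 1 : E3)).HasTemperateGrowth := by
    fun_prop
  have hdec : (2 * π * Complex.I) • G =
      -(-(2 * π * Complex.I) • SchwartzMap.smulLeftCLM ℂ
          (fun x : E3 => inner ℝ x (EuclideanSpace.single 2 1 : E3)) g)
        + (2 * π * Complex.I * (Complex.I - z)) • g := by
    ext x
    have hin : inner ℝ x (EuclideanSpace.single 2 1 : E3) = x 2 := by
      simp [EuclideanSpace.inner_single_right]
    simp only [smul_apply, add_apply, neg_apply, SchwartzMap.smulLeftCLM_apply_apply ht, hin, hG,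
      smul_eq_mul, Complex.real_smul]
    push_cast
    ring
  have h := congrArg (fun T : SchwartzMap E3 ℂ => 𝓕 T ξ) hdec
  rw [SchwartzMap.lineDerivOp_fourier_eq]
  simp only [FourierTransform.fourier_add, FourierTransform.fourier_neg,
    FourierTransform.fourier_smul, add_apply, neg_apply,
    smul_apply, smul_eq_mul] at h ⊢
  exact h

theorem integrable_phase_mul {F : E3 → ℂ} (hF : Integrable F) (x : E3) :
    Integrable fun ξ : E3 => Complex.exp ((2 * π * inner ℝ ξ x : ℝ) * Complex.I) * F ξ := by
  refine hF.bdd_mul (c := 1) (by fun_prop) (Eventually.of_forall fun ξ => ?_)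
  rw [Complex.norm_exp_ofReal_mul_I]

theorem integrable_symbol_mul {m : E3 → ℝ} (hm : Measurable m) {k : ℕ} {C : ℝ}
    (hb : ∀ ξ, |m ξ| ≤ C * ‖ξ‖ ^ k) (g : SchwartzMap E3 ℂ) :
    Integrable fun ξ => (m ξ : ℂ) * g ξ := by
  refine ((g.integrable_pow_mul volume k).const_mul C).mono' ?_ (Eventually.of_forall fun ξ => ?_)
  · exact (Complex.measurable_ofReal.comp hm).aestronglyMeasurable.mul
      g.continuous.aestronglyMeasurable
  · rw [norm_mul, Complex.norm_real, Real.norm_eq_abs, ← mul_assoc]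
    gcongr
    exact hb ξ

open LineDeriv in
/-- Commutation of a Fourier multiplier with multiplication by `x₃ - z + i`. -/
theorem fourierInv_symbol_coord_mul {m m' : E3 → ℝ} (hm : Measurable m) (hm' : Measurable m')
    {C C' : ℝ} (hb : ∀ ξ, |m ξ| ≤ C * ‖ξ‖) (hb' : ∀ ξ, |m' ξ| ≤ C')
    (hd : ∀ ξ, HasLineDerivAt ℝ m (m' ξ) ξ (EuclideanSpace.single 2 1)) {z : ℝ}
    {g G : SchwartzMap E3 ℂ} (hG : ∀ x, G x = ((x 2 - z : ℝ) + Complex.I) * g x) (x : E3) :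
    𝓕⁻ (fun ξ => 2 * π * Complex.I * (m ξ * 𝓕 G ξ)) x =
      ((x 2 - z : ℝ) + Complex.I) * 𝓕⁻ (fun ξ => 2 * π * Complex.I * (m ξ * 𝓕 g ξ)) x
        + 𝓕⁻ (fun ξ => m' ξ * 𝓕 g ξ) x := by
  set e : E3 := EuclideanSpace.single 2 1 with he
  set φ : E3 → ℂ := fun ξ => Complex.exp ((2 * π * inner ℝ ξ x : ℝ) * Complex.I) with hφ
  have hb₁ : ∀ ξ, |m ξ| ≤ C * ‖ξ‖ ^ 1 := by simpa using hb
  have hb₀ : ∀ ξ, |m' ξ| ≤ C' * ‖ξ‖ ^ 0 := by simpa using hb'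
  have I₁ := integrable_phase_mul (integrable_symbol_mul hm hb₁ (𝓕 g)) x
  have I₂ := integrable_phase_mul (integrable_symbol_mul hm hb₁ (∂_{e} (𝓕 g))) x
  have I₃ := integrable_phase_mul (integrable_symbol_mul hm' hb₀ (𝓕 g)) x
  have hφd : ∀ ξ, HasLineDerivAt ℝ φ (φ ξ * (2 * π * x 2 * Complex.I)) ξ e := fun ξ => by
    unfold HasLineDerivAt
    have h1 : HasDerivAt (fun t : ℝ => 2 * π * inner ℝ (ξ + t • e) x) (2 * π * x 2) 0 := by
      have : (fun t : ℝ => 2 * π * inner ℝ (ξ + t • e) x)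
          = fun t => 2 * π * (inner ℝ ξ x + t * x 2) := by
        funext t
        rw [inner_add_left, inner_smul_left, he, EuclideanSpace.inner_single_left]
        simp
      rw [this]
      simpa using (((hasDerivAt_id (0 : ℝ)).mul_const (x 2)).const_add (inner ℝ ξ x)).const_mul
        (2 * π)
    have h2 := (h1.ofReal_comp.mul_const Complex.I).cexp
    refine h2.congr_deriv ?_
    simp [hφ]
  have hf : ∀ ξ, HasLineDerivAt ℝ (fun ξ => φ ξ * (m ξ : ℂ))
      (φ ξ * (2 * π * x 2 * Complex.I) * m ξ + φ ξ * m' ξ) ξ e := fun ξ => by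
    refine (HasDerivAt.mul (hφd ξ) (HasDerivAt.ofReal_comp (hd ξ))).congr_deriv ?_
    simp
  have hg : ∀ ξ, HasLineDerivAt ℝ (𝓕 g : SchwartzMap E3 ℂ) ((∂_{e} (𝓕 g)) ξ) ξ e := fun ξ => by
    rw [SchwartzMap.lineDerivOp_apply_eq_fderiv]
    exact ((𝓕 g).differentiableAt.hasFDerivAt).hasLineDerivAt e
  have ibp := integral_bilinear_hasLineDerivAt_right_eq_neg_left_of_integrable
    (μ := (volume : Measure E3)) (B := ContinuousLinearMap.mul ℝ ℂ)
    (f := fun ξ => φ ξ * (m ξ : ℂ)) (g := (𝓕 g : SchwartzMap E3 ℂ)) (v := e)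
    (f' := fun ξ => φ ξ * (2 * π * x 2 * Complex.I) * m ξ + φ ξ * m' ξ)
    (g' := (∂_{e} (𝓕 g) : SchwartzMap E3 ℂ))
    (by
      refine ((I₁.const_mul (2 * π * x 2 * Complex.I)).add I₃).congr
        (Eventually.of_forall fun ξ => ?_)
      simp [hφ]
      ring)
    (by simpa [hφ, mul_assoc] using I₂) (by simpa [hφ, mul_assoc] using I₁)
    (fun ξ _ => hf ξ) (fun ξ _ => hg ξ)
  simp only [ContinuousLinearMap.mul_apply'] at ibp
  simp only [fourierInv_eq', smul_eq_mul]
  have L : ∫ ξ : E3, Complex.exp ((2 * π * inner ℝ ξ x : ℝ) * Complex.I) *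
      (2 * π * Complex.I * (m ξ * 𝓕 G ξ)) =
      -(∫ ξ, φ ξ * m ξ * (∂_{e} (𝓕 g)) ξ)
        + 2 * π * Complex.I * (Complex.I - z) * ∫ ξ, φ ξ * (m ξ * 𝓕 g ξ) := by
    rw [← integral_const_mul, ← integral_neg, ← integral_add]
    · refine integral_congr_ae (Eventually.of_forall fun ξ => ?_)
      have := fourier_eq_lineDeriv_add_of_eq_coord_mul hG ξ
      simp only
      linear_combination (φ ξ * m ξ) * this
    · simpa [hφ, mul_assoc] using I₂.neg
    · exact I₁.const_mul _
  have R : ∫ ξ, (φ ξ * (2 * π * x 2 * Complex.I) * m ξ + φ ξ * m' ξ) * 𝓕 g ξ =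
      2 * π * x 2 * Complex.I * (∫ ξ, φ ξ * (m ξ * 𝓕 g ξ)) + ∫ ξ, φ ξ * (m' ξ * 𝓕 g ξ) := by
    rw [← integral_const_mul, ← integral_add (I₁.const_mul _) I₃]
    refine integral_congr_ae (Eventually.of_forall fun ξ => ?_)
    simp only
    ring
  have S : ∫ ξ : E3, Complex.exp ((2 * π * inner ℝ ξ x : ℝ) * Complex.I) *
      (2 * π * Complex.I * (m ξ * 𝓕 g ξ)) = 2 * π * Complex.I * ∫ ξ, φ ξ * (m ξ * 𝓕 g ξ) := by
    rw [← integral_const_mul]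
    refine integral_congr_ae (Eventually.of_forall fun ξ => ?_)
    simp only [hφ]
    ring
  have T : ∫ ξ : E3, Complex.exp ((2 * π * inner ℝ ξ x : ℝ) * Complex.I) * (m' ξ * 𝓕 g ξ) =
      ∫ ξ, φ ξ * (m' ξ * 𝓕 g ξ) := rfl
  simp only [SchwartzMap.fourier_coe] at L S T R ibp ⊢
  rw [L, S, T, ibp, R]
  push_cast
  ring

theorem summable_one_div_one_add_int_sq : Summable fun n : ℤ => 1 / (1 + (n : ℝ) ^ 2) := by
  refine Summable.of_norm_bounded_eventually
    ((Real.summable_one_div_int_pow (p := 2)).2 one_lt_two) ?_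
  have : ∀ᶠ n : ℤ in cofinite, n ≠ 0 := (Set.finite_singleton 0).compl_mem_cofinite
  filter_upwards [this] with n hn
  have hn' : (0 : ℝ) < (n : ℝ) ^ 2 := by positivity
  rw [Real.norm_of_nonneg (by positivity)]
  gcongr
  linarith

theorem norm_ofReal_add_I_sq (t : ℝ) : ‖(t : ℂ) + Complex.I‖ ^ 2 = 1 + t ^ 2 := by
  rw [← Complex.normSq_eq_norm_sq, Complex.normSq_apply]
  simp
  ring

theorem ofReal_add_I_ne_zero (t : ℝ) : (t : ℂ) + Complex.I ≠ 0 := fun h => by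
  have := congrArg Complex.im h
  simp at this

/-- A function dominated by `⟨x₃ - z⟩⁻¹ |h|` has global `L²` norm controlled by the uniformly local
`L²` norm of `h`. -/
theorem exists_eLpNorm_le_uloc3_of_weight : ∃ K : ℝ≥0∞, K ≠ ∞ ∧
    ∀ {F F' : Type} [NormedAddCommGroup F] [NormedAddCommGroup F'] (z : ℝ) (G : E3 → F)
      (h : E3 → F'), (∀ x, ‖((x 2 - z : ℝ) : ℂ) + Complex.I‖ * ‖G x‖ ≤ ‖h x‖) →
      eLpNorm G 2 volume ≤ K * uloc3 h 2 := by
  set c : ℤ → ℝ≥0∞ := fun n => ENNReal.ofReal (1 / (1 + (n : ℝ) ^ 2)) with hc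
  have hcs : ∑' n, c n ≠ ∞ := summable_one_div_one_add_int_sq.tsum_ofReal_ne_top
  refine ⟨1 + ∑' n, c n, by simp [hcs], fun {F F'} _ _ z G h hGh => ?_⟩
  set S : ℤ → Set E3 := fun n => Set.univ ∩ {x : E3 | x 2 ∈ Set.Icc (z + 2 * n - 1) (z + 2 * n + 1)}
    with hS
  have hSm : ∀ n, MeasurableSet (S n) := fun n =>
    MeasurableSet.univ.inter (measurableSet_Icc.preimage (by fun_prop))
  have hcover : ⋃ n, S n = Set.univ := by
    refine Set.eq_univ_of_forall fun x => Set.mem_iUnion.2 ⟨round ((x 2 - z) / 2), ?_⟩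
    have := abs_le.1 (abs_sub_round ((x 2 - z) / 2))
    simp only [hS, Set.univ_inter, Set.mem_ofPred_eq, Set.mem_Icc]
    constructor <;> linarith [this.1, this.2]
  have hsq : ∀ {F : Type} [NormedAddCommGroup F] (u : E3 → F) (μ : Measure E3),
      eLpNorm u 2 μ ^ 2 = ∫⁻ x, ‖u x‖ₑ ^ 2 ∂μ := fun u μ => by
    have := eLpNorm_nnreal_pow_eq_lintegral (f := u) (μ := μ) (p := 2) two_ne_zero
    simpa using this
  have hpt : ∀ n, ∀ x ∈ S n, ‖G x‖ₑ ^ 2 ≤ c n * ‖h x‖ₑ ^ 2 := by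
    intro n x hx
    simp only [hS, Set.univ_inter, Set.mem_ofPred_eq, Set.mem_Icc] at hx
    have hn : (1 + (n : ℝ) ^ 2) ≤ ‖((x 2 - z : ℝ) : ℂ) + Complex.I‖ ^ 2 := by
      rw [norm_ofReal_add_I_sq]
      set t := x 2 - z with ht
      have h1 : -1 ≤ t - 2 * n ∧ t - 2 * n ≤ 1 := ⟨by linarith [hx.1], by linarith [hx.2]⟩
      rcases lt_trichotomy n 0 with h0 | h0 | h0
      · have : (n : ℝ) ≤ -1 := by exact_mod_cast Int.le_sub_one_of_lt h0
        nlinarith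
      · subst h0
        have := sq_nonneg t
        simp
        positivity
      · have : (1 : ℝ) ≤ n := by exact_mod_cast h0
        nlinarith
    have h2 : ‖G x‖ ^ 2 ≤ 1 / (1 + (n : ℝ) ^ 2) * ‖h x‖ ^ 2 := by
      rw [one_div, inv_mul_eq_div, le_div_iff₀ (by positivity)]
      calc ‖G x‖ ^ 2 * (1 + (n : ℝ) ^ 2)
          ≤ ‖G x‖ ^ 2 * ‖((x 2 - z : ℝ) : ℂ) + Complex.I‖ ^ 2 := by gcongr
        _ = (‖((x 2 - z : ℝ) : ℂ) + Complex.I‖ * ‖G x‖) ^ 2 := by ring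
        _ ≤ ‖h x‖ ^ 2 := by gcongr; exact hGh x
    rw [← ofReal_norm, ← ofReal_norm, hc, ← ENNReal.ofReal_pow (norm_nonneg _),
      ← ENNReal.ofReal_pow (norm_nonneg _), ← ENNReal.ofReal_mul (by positivity)]
    exact ENNReal.ofReal_le_ofReal h2
  have hslab : ∀ n, ∫⁻ x in S n, ‖G x‖ₑ ^ 2 ≤ c n * uloc3 h 2 ^ 2 := fun n =>
    calc ∫⁻ x in S n, ‖G x‖ₑ ^ 2 ≤ ∫⁻ x in S n, c n * ‖h x‖ₑ ^ 2 :=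
          setLIntegral_mono' (hSm n) (hpt n)
      _ = c n * eLpNorm h 2 (volume.restrict (S n)) ^ 2 := by
          rw [lintegral_const_mul' _ _ ENNReal.ofReal_ne_top, hsq]
      _ ≤ c n * uloc3 h 2 ^ 2 := by
          gcongr
          exact le_iSup (fun z : ℝ => eLpNorm h 2
            (volume.restrict (Set.univ ∩ {x : E3 | x 2 ∈ Set.Icc (z - 1) (z + 1)}))) (z + 2 * n)
  refine (ENNReal.pow_le_pow_left_iff two_ne_zero).1 ?_
  calc eLpNorm G 2 volume ^ 2 = ∫⁻ x in ⋃ n, S n, ‖G x‖ₑ ^ 2 := by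
        rw [hsq, hcover, Measure.restrict_univ]
    _ ≤ ∑' n, ∫⁻ x in S n, ‖G x‖ₑ ^ 2 := lintegral_iUnion_le _ _
    _ ≤ ∑' n, c n * uloc3 h 2 ^ 2 := ENNReal.tsum_le_tsum hslab
    _ = (∑' n, c n) * uloc3 h 2 ^ 2 := ENNReal.tsum_mul_right
    _ ≤ (1 + ∑' n, c n) ^ 2 * uloc3 h 2 ^ 2 := by
        gcongr
        calc ∑' n, c n ≤ 1 + ∑' n, c n := le_add_self
          _ ≤ (1 + ∑' n, c n) ^ 2 := le_self_pow₀ le_self_add two_ne_zero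
    _ = ((1 + ∑' n, c n) * uloc3 h 2) ^ 2 := by rw [mul_pow]

theorem ofReal_sub_I_mul_rpow_neg_one (t : ℝ) :
    ((t : ℂ) - Complex.I) * (((1 + ‖t‖ ^ 2) ^ (-1 : ℝ) : ℝ) : ℂ) = ((t : ℂ) + Complex.I)⁻¹ := by
  have ht : (1 + (t : ℂ) ^ 2) ≠ 0 := by
    have : (1 + t ^ 2 : ℝ) ≠ 0 := by positivity
    exact_mod_cast this
  refine eq_inv_of_mul_eq_one_left ?_
  rw [Real.rpow_neg_one, Real.norm_eq_abs, sq_abs]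
  push_cast
  field_simp
  linear_combination -Complex.I_sq

theorem hasTemperateGrowth_inv_coord_add_I (z : ℝ) :
    (fun x : E3 => (((x 2 - z : ℝ) : ℂ) + Complex.I)⁻¹).HasTemperateGrowth := by
  have h1 : (fun x : E3 => x 2 - z).HasTemperateGrowth :=
    ((EuclideanSpace.proj (𝕜 := ℝ) (2 : Fin 3)).hasTemperateGrowth).sub (.const z)
  have h2 : (fun x : E3 => ((x 2 - z : ℝ) : ℂ)).HasTemperateGrowth :=
    Function.Complex.hasTemperateGrowth_ofReal.comp h1
  have h3 : (fun x : E3 => (((1 + ‖x 2 - z‖ ^ 2) ^ (-1 : ℝ) : ℝ) : ℂ)).HasTemperateGrowth :=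
    Function.Complex.hasTemperateGrowth_ofReal.comp
      ((Function.hasTemperateGrowth_one_add_norm_sq_rpow ℝ (-1)).comp h1)
  refine Eq.mp (congrArg _ (funext fun x => ?_)) ((h2.sub (.const Complex.I)).mul h3)
  exact ofReal_sub_I_mul_rpow_neg_one (x 2 - z)

open LineDeriv in
theorem lineDeriv_eq_inv_coord_mul {i : Fin 3} (hi : i ≠ 2) {z : ℝ} {Γ : SchwartzMap E3 ℝ}
    {g : SchwartzMap E3 ℂ} (hg : ∀ x, g x = (((x 2 - z : ℝ) : ℂ) + Complex.I)⁻¹ * Γ x) (x : E3) :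
    (∂_{(EuclideanSpace.single i 1 : E3)} g) x =
      (((x 2 - z : ℝ) : ℂ) + Complex.I)⁻¹ *
        (fderiv ℝ Γ x (EuclideanSpace.single i 1) : ℝ) := by
  set e : E3 := EuclideanSpace.single i 1 with he
  rw [SchwartzMap.lineDerivOp_apply_eq_fderiv]
  have h1 : HasLineDerivAt ℝ g (fderiv ℝ g x e) x e :=
    g.differentiableAt.hasFDerivAt.hasLineDerivAt e
  have h2 : HasLineDerivAt ℝ Γ (fderiv ℝ Γ x e) x e :=
    Γ.differentiableAt.hasFDerivAt.hasLineDerivAt e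
  have h3 : (fun t : ℝ => g (x + t • e)) =
      fun t => (((x 2 - z : ℝ) : ℂ) + Complex.I)⁻¹ * Γ (x + t • e) := by
    funext t
    rw [hg]
    simp [he, hi.symm]
  unfold HasLineDerivAt at h1
  rw [h3] at h1
  exact h1.unique ((HasDerivAt.ofReal_comp h2).const_mul _)

/-- `L²` bound for the inverse Fourier integral of a symbol dominated by the Fourier transform of a
Schwartz function. -/
theorem continuous_and_eLpNorm_fourierInv_le {H : E3 → ℂ} (hH : Measurable H) {h : SchwartzMap E3 ℂ}
    {C : ℝ} (hb : ∀ ξ, ‖H ξ‖ ≤ C * ‖𝓕 h ξ‖) :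
    Continuous (𝓕⁻ H) ∧ eLpNorm (𝓕⁻ H) 2 volume ≤ ENNReal.ofReal C * eLpNorm h 2 volume := by
  have hmem : ∀ p, MemLp H p volume := fun p =>
    ((𝓕 h).memLp p volume).of_le_mul hH.aestronglyMeasurable (Eventually.of_forall hb)
  have h1 : Integrable H := memLp_one_iff_integrable.1 (hmem 1)
  refine ⟨?_, ?_⟩
  · have : 𝓕⁻ H = 𝓕 H ∘ Neg.neg := funext fun x => fourierInv_eq_fourier_neg H x
    rw [this]
    exact (VectorFourier.fourierIntegral_continuous Real.continuous_fourierChar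
      (by exact continuous_inner) h1).comp continuous_neg
  · rw [eLpNorm_fourierInv_eq_of_integrable h1 (hmem 2),
      ← eLpNorm_fourier_eq_of_integrable h.integrable (h.memLp 2 volume)]
    exact eLpNorm_le_mul_eLpNorm_of_ae_le_mul (Eventually.of_forall hb) 2

open LineDeriv in
theorem norm_two_pi_I_biLapSymbol_mul_fourier_le (i a b c d : Fin 3) (g : SchwartzMap E3 ℂ)
    (ξ : E3) :
    ‖2 * π * Complex.I * (biLapSymbol i a b c d ξ * 𝓕 g ξ)‖ ≤
      ‖𝓕 (∂_{(EuclideanSpace.single i 1 : E3)} g) ξ‖ := by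
  have ht : (fun x : E3 => inner ℝ x (EuclideanSpace.single i 1 : E3)).HasTemperateGrowth := by
    fun_prop
  have hin : inner ℝ ξ (EuclideanSpace.single i 1 : E3) = ξ i := by
    simp [EuclideanSpace.inner_single_right]
  rw [SchwartzMap.fourier_lineDerivOp_eq, smul_apply, SchwartzMap.smulLeftCLM_apply_apply ht, hin,
    smul_eq_mul, norm_mul, norm_mul _ (ξ i • _), norm_mul, norm_smul,
    norm_mul ((biLapSymbol i a b c d ξ : ℝ) : ℂ), Complex.norm_real, Real.norm_eq_abs,
    Real.norm_eq_abs]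
  exact mul_le_mul_of_nonneg_left (mul_le_mul_of_nonneg_right (abs_biLapSymbol_le i a b c d ξ)
    (norm_nonneg _)) (by positivity)

/-- `L²`-3-uloc estimate for the bi-Laplacian multiplier `∂_a∂_b∂_c∂_d Δ⁻² ∂_i`. -/
theorem stmt14 (i a b c d : Fin 3) (hi : i = 0 ∨ i = 1) :
    ∃ C : ℝ, 0 < C ∧
      ∀ Γ : SchwartzMap E3 ℝ,
        uloc3 (fun x => ∫ ξ : E3,
            Complex.exp (((2 * π * ∑ k : Fin 3, x k * ξ k : ℝ) : ℂ) * Complex.I) *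
              ((((2 * π : ℝ) : ℂ) * Complex.I * ((ξ i : ℝ) : ℂ)) *
                (((ξ a * ξ b * ξ c * ξ d / ‖ξ‖ ^ 4 : ℝ)) : ℂ) *
                𝓕 (fun y => ((Γ y : ℝ) : ℂ)) ξ)) 2 ≤
        ENNReal.ofReal C *
          (uloc3 (⇑Γ) 2 + uloc3 (fun y => fderiv ℝ (⇑Γ) y) 2) := by
  have hi2 : i ≠ 2 := by rcases hi with rfl | rfl <;> decide
  obtain ⟨K, hK, hKb⟩ := exists_eLpNorm_le_uloc3_of_weight
  refine ⟨8 * K.toReal + 1, by positivity, fun Γ => iSup_le fun z => ?_⟩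
  set Γc : SchwartzMap E3 ℂ := SchwartzMap.postcompCLM Complex.ofRealCLM Γ with hΓc
  have hΓcx : ∀ x, Γc x = (Γ x : ℂ) := fun x => rfl
  set g : SchwartzMap E3 ℂ :=
    SchwartzMap.smulLeftCLM ℂ (fun x : E3 => (((x 2 - z : ℝ) : ℂ) + Complex.I)⁻¹) Γc with hg
  have hgx : ∀ x, g x = (((x 2 - z : ℝ) : ℂ) + Complex.I)⁻¹ * Γ x := fun x => by
    rw [hg, SchwartzMap.smulLeftCLM_apply_apply (hasTemperateGrowth_inv_coord_add_I z), smul_eq_mul,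
      hΓcx]
  have hX := fun x : E3 => ofReal_add_I_ne_zero (x 2 - z)
  have hG : ∀ x, Γc x = (((x 2 - z : ℝ) : ℂ) + Complex.I) * g x := fun x => by
    rw [hgx, mul_inv_cancel_left₀ (hX x), hΓcx]
  have hg2 : eLpNorm g 2 volume ≤ K * uloc3 Γ 2 := hKb z _ _ fun x => by
    rw [← norm_mul, ← hG, hΓcx, Complex.norm_real]
  have hdg2 : eLpNorm (LineDeriv.lineDerivOp (EuclideanSpace.single i 1 : E3) g) 2 volume
      ≤ K * uloc3 (fun y => fderiv ℝ Γ y) 2 := hKb z _ _ fun x => by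
    rw [lineDeriv_eq_inv_coord_mul hi2 hgx, ← norm_mul, mul_inv_cancel_left₀ (hX x),
      Complex.norm_real]
    simpa using (fderiv ℝ Γ x).le_opNorm (EuclideanSpace.single i 1)
  have hgm : Measurable (𝓕 g : SchwartzMap E3 ℂ) := (𝓕 g).continuous.measurable
  obtain ⟨hAc, hA⟩ := continuous_and_eLpNorm_fourierInv_le (C := 1)
    (H := fun ξ => 2 * π * Complex.I * (biLapSymbol i a b c d ξ * 𝓕 g ξ))
    (((Complex.measurable_ofReal.comp (measurable_biLapSymbol i a b c d)).mul hgm).const_mul _)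
    (fun ξ => (norm_two_pi_I_biLapSymbol_mul_fourier_le i a b c d g ξ).trans_eq (one_mul _).symm)
  obtain ⟨hBc, hB⟩ := continuous_and_eLpNorm_fourierInv_le (C := 8) (h := g)
    (H := fun ξ => biLapSymbolDeriv i a b c d ξ * 𝓕 g ξ)
    ((Complex.measurable_ofReal.comp (measurable_biLapSymbolDeriv i a b c d)).mul hgm)
    (fun ξ => by
      rw [norm_mul, Complex.norm_real]
      gcongr
      exact abs_biLapSymbolDeriv_le i a b c d ξ)
  rw [ENNReal.ofReal_one, one_mul] at hA
  rw [ENNReal.ofReal_ofNat] at hB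
  set A := 𝓕⁻ (fun ξ => 2 * π * Complex.I * (biLapSymbol i a b c d ξ * 𝓕 g ξ))
  set B := 𝓕⁻ (fun ξ => biLapSymbolDeriv i a b c d ξ * 𝓕 g ξ)
  have hf : ∀ x : E3, (∫ ξ : E3,
      Complex.exp (((2 * π * ∑ k : Fin 3, x k * ξ k : ℝ) : ℂ) * Complex.I) *
        ((((2 * π : ℝ) : ℂ) * Complex.I * ((ξ i : ℝ) : ℂ)) *
          (((ξ a * ξ b * ξ c * ξ d / ‖ξ‖ ^ 4 : ℝ)) : ℂ) *
          𝓕 (fun y => ((Γ y : ℝ) : ℂ)) ξ)) = (((x 2 - z : ℝ) : ℂ) + Complex.I) * A x + B x := by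
    intro x
    rw [← fourierInv_symbol_coord_mul (measurable_biLapSymbol i a b c d)
      (measurable_biLapSymbolDeriv i a b c d) (C := 1)
      (fun ξ => by
        simpa using (abs_biLapSymbol_le i a b c d ξ).trans (abs_coord_le_norm ξ i))
      (abs_biLapSymbolDeriv_le i a b c d) (hasLineDerivAt_biLapSymbol a b c d hi2) hG x,
      fourierInv_eq']
    refine integral_congr_ae (Eventually.of_forall fun ξ => ?_)
    have hin : inner ℝ ξ x = ∑ k : Fin 3, x k * ξ k := by
      simp [PiLp.inner_apply]
    have hF : (𝓕 Γc) ξ = 𝓕 (fun y => ((Γ y : ℝ) : ℂ)) ξ := rfl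
    simp only [hin, hF, biLapSymbol, smul_eq_mul]
    push_cast
    ring
  simp only [hf]
  set s : Set E3 := Set.univ ∩ {x : E3 | x 2 ∈ Set.Icc (z - 1) (z + 1)} with hs
  have hsm : MeasurableSet s := MeasurableSet.univ.inter (measurableSet_Icc.preimage (by fun_prop))
  calc eLpNorm (fun x : E3 => (((x 2 - z : ℝ) : ℂ) + Complex.I) * A x + B x) 2 (volume.restrict s)
      ≤ eLpNorm (fun x => ‖(2 : ℂ) * A x‖ + ‖B x‖) 2 (volume.restrict s) := by
        refine eLpNorm_mono_ae_real ((ae_restrict_iff' hsm).2 (Eventually.of_forall fun x hx => ?_))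
        simp only [hs, Set.univ_inter, Set.mem_ofPred_eq, Set.mem_Icc] at hx
        refine (norm_add_le _ _).trans (add_le_add ?_ le_rfl)
        rw [norm_mul, norm_mul]
        gcongr
        refine (norm_add_le _ _).trans ?_
        rw [Complex.norm_real, Complex.norm_I, Real.norm_eq_abs]
        have : |x 2 - z| ≤ 1 := abs_le.2 ⟨by linarith [hx.1], by linarith [hx.2]⟩
        simp
        linarith
    _ ≤ eLpNorm (fun x => (2 : ℂ) * A x) 2 (volume.restrict s)
          + eLpNorm B 2 (volume.restrict s) := by
        refine (eLpNorm_add_le (hAc.aestronglyMeasurable.const_mul 2).norm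
          hBc.aestronglyMeasurable.norm one_le_two).trans ?_
        rw [eLpNorm_norm, eLpNorm_norm]
    _ ≤ 2 * eLpNorm A 2 volume + eLpNorm B 2 volume := by
        gcongr
        · refine (eLpNorm_mono_measure _ Measure.restrict_le_self).trans_eq ?_
          exact (eLpNorm_const_smul (2 : ℂ) A 2 volume).trans (by
            rw [← ofReal_norm, Complex.norm_ofNat, ENNReal.ofReal_ofNat])
        · exact Measure.restrict_le_self
    _ ≤ 2 * (K * uloc3 (fun y => fderiv ℝ Γ y) 2) + 8 * (K * uloc3 Γ 2) := by
        gcongr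
        · exact hA.trans hdg2
        · exact hB.trans (by gcongr)
    _ ≤ 8 * K * (uloc3 Γ 2 + uloc3 (fun y => fderiv ℝ Γ y) 2) := by
        rw [mul_add, add_comm, ← mul_assoc, ← mul_assoc]
        gcongr
        norm_num
    _ ≤ ENNReal.ofReal (8 * K.toReal + 1) * (uloc3 Γ 2 + uloc3 (fun y => fderiv ℝ Γ y) 2) := by
        gcongr
        rw [ENNReal.ofReal_add (by positivity) zero_le_one, ENNReal.ofReal_mul (by norm_num),
          ENNReal.ofReal_toReal hK]
        simp
end
end
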